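/- arXiv:gr-qc/0612014 — 7 statements merged into one kernel-verified Lean document; each statement's English description precedes it below -/
import Mathlib

section
/- For every point x ∈ M, the quadratic form V ↦ Q_x(V) on ℝ × ℝ^d × ℝ is equivalent (isometric as a real quadratic form) to the standard Lorentzian quadratic form of signature (d+1,1), i.e. to z ↦ z₁² + ⋯ + z_{d+1}² − z_{d+2}² on ℝ^{d+2}. In particular the Eisenhart metric g is a Lorentzian metric on M. -/
open Set

/-- The Eisenhart metric on `M = ℝ × (Fin d → ℝ) × ℝ`:
`g_x(V,V') = a(t,q)(v,v') − ψ·(τ(υ'−b v') + τ'(υ−b v)) − (2U+1)ψ²ττ'`. -/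
noncomputable def eisG {d : ℕ}
    (a : ℝ → (Fin d → ℝ) → (Fin d → ℝ) → (Fin d → ℝ) → ℝ)
    (b : ℝ → (Fin d → ℝ) → (Fin d → ℝ) → ℝ)
    (U ψ : ℝ → (Fin d → ℝ) → ℝ)
    (x V V' : ℝ × (Fin d → ℝ) × ℝ) : ℝ :=
  a x.1 x.2.1 V.2.1 V'.2.1
    - ψ x.1 x.2.1 * (V.1 * (V'.2.2 - b x.1 x.2.1 V'.2.1)
        + V'.1 * (V.2.2 - b x.1 x.2.1 V.2.1))
    - (2 * U x.1 x.2.1 + 1) * (ψ x.1 x.2.1) ^ 2 * V.1 * V'.1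

/-- A positive definite real quadratic form is linearly equivalent to the sum of squares. -/
theorem exists_linearEquiv_eq_sum_sq_of_posDef {d : ℕ} (Q : QuadraticForm ℝ (Fin d → ℝ))
    (hQ : Q.PosDef) :
    ∃ E : (Fin d → ℝ) ≃ₗ[ℝ] (Fin d → ℝ), ∀ v, Q v = ∑ i, E v i ^ 2 := by
  obtain ⟨w, ⟨e⟩⟩ := Q.equivalent_signType_weighted_sum_squared
  have hn : Module.finrank ℝ (Fin d → ℝ) = d := by simp
  have hw : ∀ i, (w i : ℝ) = 1 := by
    intro i
    have h : Q (e.symm (Pi.single i 1)) = (w i : ℝ) := by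
      rw [QuadraticMap.IsometryEquiv.map_app, QuadraticMap.weightedSumSquares_apply,
        Finset.sum_eq_single i]
      · simp
      · intro j _ hj
        simp [hj]
      · simp
    have hpos : 0 < (w i : ℝ) := by
      rw [← h]
      refine hQ _ fun h0 => ?_
      have h1 := congrArg e h0
      simp at h1
    revert hpos
    cases w i <;> simp
  refine ⟨e.toLinearEquiv.trans (LinearEquiv.funCongrLeft ℝ ℝ (finCongr hn.symm)), fun v => ?_⟩
  rw [← e.map_app, QuadraticMap.weightedSumSquares_apply]
  refine Fintype.sum_equiv (finCongr hn) _ _ fun i => ?_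
  simp [hw, LinearEquiv.funCongrLeft, pow_two]

/-- At every point of the Eisenhart spacetime the quadratic form `Q_x` is linearly
equivalent to the standard Lorentzian quadratic form of signature `(d+1,1)` on `ℝ^{d+2}`;
in particular the Eisenhart metric is Lorentzian. -/
theorem eisenhart_metric_is_lorentzian (d : ℕ) (hd : 1 ≤ d)
    (a : ℝ → (Fin d → ℝ) → (Fin d → ℝ) → (Fin d → ℝ) → ℝ)
    (b : ℝ → (Fin d → ℝ) → (Fin d → ℝ) → ℝ)
    (U ψ : ℝ → (Fin d → ℝ) → ℝ)
    (hsymm : ∀ t q v w, a t q v w = a t q w v)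
    (halin : ∀ t q w, IsLinearMap ℝ (fun v => a t q v w))
    (hapos : ∀ t q v, v ≠ 0 → 0 < a t q v v)
    (hblin : ∀ t q, IsLinearMap ℝ (b t q))
    (hψpos : ∀ t q, 0 < ψ t q)
    (hareg : ∀ v w, ContDiff ℝ 1 (fun p : ℝ × (Fin d → ℝ) => a p.1 p.2 v w))
    (hbreg : ∀ v, ContDiff ℝ 1 (fun p : ℝ × (Fin d → ℝ) => b p.1 p.2 v))
    (hUreg : ContDiff ℝ 1 (fun p : ℝ × (Fin d → ℝ) => U p.1 p.2))
    (hψreg : ContDiff ℝ 1 (fun p : ℝ × (Fin d → ℝ) => ψ p.1 p.2))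
    (x : ℝ × (Fin d → ℝ) × ℝ) :
    ∃ L : (ℝ × (Fin d → ℝ) × ℝ) ≃ₗ[ℝ] (Fin (d + 2) → ℝ),
      ∀ V, eisG a b U ψ x V V =
        (∑ i : Fin (d + 1), L V i.castSucc ^ 2) - L V (Fin.last (d + 1)) ^ 2 := by
  obtain ⟨t, q, y⟩ := x
  let A : LinearMap.BilinForm ℝ (Fin d → ℝ) := LinearMap.mk₂ ℝ (a t q)
    (fun v v' w => (halin t q w).map_add v v') (fun c v w => (halin t q w).map_smul c v)
    (fun v w w' => by
      rw [hsymm, (halin t q v).map_add, hsymm t q w, hsymm t q w'])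
    (fun c v w => by
      rw [hsymm, (halin t q v).map_smul, hsymm t q w])
  obtain ⟨E, hE⟩ := exists_linearEquiv_eq_sum_sq_of_posDef A.toQuadraticMap
    fun v hv => hapos t q v hv
  replace hE : ∀ v, a t q v v = ∑ i, E v i ^ 2 := hE
  let w : ℝ × (Fin d → ℝ) × ℝ → ℝ := fun V =>
    2 * ψ t q * (V.2.2 - b t q V.2.1) + (2 * U t q + 1) * ψ t q ^ 2 * V.1
  have hwadd : ∀ V V', w (V + V') = w V + w V' := fun V V' => by
    simp only [w, Prod.fst_add, Prod.snd_add, (hblin t q).map_add]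
    ring
  have hwsmul : ∀ (c : ℝ) V, w (c • V) = c * w V := fun c V => by
    simp only [w, Prod.smul_fst, Prod.smul_snd, (hblin t q).map_smul, smul_eq_mul]
    ring
  let F : (ℝ × (Fin d → ℝ) × ℝ) →ₗ[ℝ] (Fin (d + 2) → ℝ) :=
    { toFun := fun V => Fin.snoc (α := fun _ => ℝ)
        (Fin.snoc (α := fun _ => ℝ) (E V.2.1) ((V.1 - w V) / 2)) ((V.1 + w V) / 2)
      map_add' := fun V V' => by
        ext i
        refine Fin.lastCases ?_ (fun i => Fin.lastCases ?_ (fun i => ?_) i) i <;>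
          simp only [Pi.add_apply, Fin.snoc_last, Fin.snoc_castSucc, hwadd, Prod.fst_add,
            Prod.snd_add, map_add] <;> ring
      map_smul' := fun c V => by
        ext i
        refine Fin.lastCases ?_ (fun i => Fin.lastCases ?_ (fun i => ?_) i) i <;>
          simp only [Pi.smul_apply, Fin.snoc_last, Fin.snoc_castSucc, hwsmul, Prod.smul_fst,
            Prod.smul_snd, map_smul, smul_eq_mul, RingHom.id_apply] <;> ring }
  have hFlast : ∀ V, F V (Fin.last (d + 1)) = (V.1 + w V) / 2 := fun V => by simp [F]
  have hFmid : ∀ V, F V (Fin.last d).castSucc = (V.1 - w V) / 2 := fun V => by simp [F]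
  have hFinit : ∀ V (i : Fin d), F V i.castSucc.castSucc = E V.2.1 i := fun V i => by simp [F]
  have hF : Function.Injective F := by
    rw [← LinearMap.ker_eq_bot, LinearMap.ker_eq_bot']
    rintro ⟨τ, v, υ⟩ h
    have h1 := hFlast (τ, v, υ)
    have h2 := hFmid (τ, v, υ)
    have h3 : E v = 0 := funext fun i => by simpa [h] using (hFinit (τ, v, υ) i).symm
    have hv : v = 0 := by simpa using h3
    simp only [h, Pi.zero_apply] at h1 h2
    have hτ : τ = 0 := by linarith
    have hw : w (τ, v, υ) = 0 := by linarith
    have hυ : υ = 0 := by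
      simpa [w, hτ, hv, (hblin t q).map_zero, (hψpos t q).ne'] using hw
    simp [hτ, hv, hυ]
  refine ⟨F.linearEquivOfInjective hF (by simp; ring), fun V => ?_⟩
  simp only [LinearMap.linearEquivOfInjective_apply, Fin.sum_univ_castSucc, hFlast, hFmid,
    hFinit, ← hE, eisG, w]
  ring
end

section
/- Let x : [λ₀,λ₁] → M (λ₀ < λ₁) be a C¹ timelike curve, i.e. Q_{x(λ)}(x'(λ)) < 0 for all λ. Then the derivative of the t-component of x never vanishes and therefore has constant sign on [λ₀,λ₁]; in particular the time function t is strictly monotone along every timelike curve. -/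
open Set

/-- Along a C¹ timelike curve the derivative of the time component never vanishes,
has constant sign, and hence the time function is strictly monotone. -/
theorem time_strictly_monotone_on_timelike_curves (d : ℕ) (hd : 1 ≤ d)
    (a : ℝ → (Fin d → ℝ) → (Fin d → ℝ) → (Fin d → ℝ) → ℝ)
    (b : ℝ → (Fin d → ℝ) → (Fin d → ℝ) → ℝ)
    (U ψ : ℝ → (Fin d → ℝ) → ℝ)
    (hsymm : ∀ t q v w, a t q v w = a t q w v)
    (halin : ∀ t q w, IsLinearMap ℝ (fun v => a t q v w))
    (hapos : ∀ t q v, v ≠ 0 → 0 < a t q v v)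
    (hblin : ∀ t q, IsLinearMap ℝ (b t q))
    (hψpos : ∀ t q, 0 < ψ t q)
    (hareg : ∀ v w, ContDiff ℝ 1 (fun p : ℝ × (Fin d → ℝ) => a p.1 p.2 v w))
    (hbreg : ∀ v, ContDiff ℝ 1 (fun p : ℝ × (Fin d → ℝ) => b p.1 p.2 v))
    (hUreg : ContDiff ℝ 1 (fun p : ℝ × (Fin d → ℝ) => U p.1 p.2))
    (hψreg : ContDiff ℝ 1 (fun p : ℝ × (Fin d → ℝ) => ψ p.1 p.2))
    (lam₀ lam₁ : ℝ) (hlam : lam₀ < lam₁)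
    (x x' : ℝ → ℝ × (Fin d → ℝ) × ℝ)
    (hx : ∀ l ∈ Icc lam₀ lam₁, HasDerivWithinAt x (x' l) (Icc lam₀ lam₁) l)
    (hx' : ContinuousOn x' (Icc lam₀ lam₁))
    (htimelike : ∀ l ∈ Icc lam₀ lam₁, eisG a b U ψ (x l) (x' l) (x' l) < 0) :
    (∀ l ∈ Icc lam₀ lam₁, (x' l).1 ≠ 0) ∧
    ((∀ l ∈ Icc lam₀ lam₁, 0 < (x' l).1) ∨ (∀ l ∈ Icc lam₀ lam₁, (x' l).1 < 0)) ∧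
    (StrictMonoOn (fun l => (x l).1) (Icc lam₀ lam₁) ∨
      StrictAntiOn (fun l => (x l).1) (Icc lam₀ lam₁)) := by
  have hne : ∀ l ∈ Icc lam₀ lam₁, (x' l).1 ≠ 0 := by
    intro l hl h0
    have hQ := htimelike l hl
    simp only [eisG, h0, zero_mul, mul_zero, add_zero, sub_zero] at hQ
    by_cases hv : (x' l).2.1 = 0
    · have hz := (halin (x l).1 (x l).2.1 0).map_zero
      simp only [hv, hz, lt_self_iff_false] at hQ
    · exact lt_asymm hQ (hapos _ _ _ hv)
  have hcont : ContinuousOn (fun l => (x' l).1) (Icc lam₀ lam₁) := hx'.fst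
  have hfst : ∀ l ∈ Icc lam₀ lam₁,
      HasDerivWithinAt (fun l => (x l).1) (x' l).1 (Icc lam₀ lam₁) l := fun l hl => by
    simpa using (hx l hl).hasFDerivWithinAt.fst.hasDerivWithinAt
  have hder : ∀ l ∈ interior (Icc lam₀ lam₁),
      HasDerivWithinAt (fun l => (x l).1) (x' l).1 (interior (Icc lam₀ lam₁)) l :=
    fun l hl => (hfst l (interior_subset hl)).mono interior_subset
  have hxcont : ContinuousOn (fun l => (x l).1) (Icc lam₀ lam₁) :=
    fun l hl => (hfst l hl).continuousWithinAt
  have hsign : (∀ l ∈ Icc lam₀ lam₁, 0 < (x' l).1) ∨ (∀ l ∈ Icc lam₀ lam₁, (x' l).1 < 0) := by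
    by_contra! h
    obtain ⟨⟨l, hl, hl'⟩, m, hm, hm'⟩ := h
    obtain ⟨k, hk, hk'⟩ := isPreconnected_Icc.intermediate_value hl hm hcont ⟨hl', hm'⟩
    exact hne k hk hk'
  refine ⟨hne, hsign, hsign.imp (fun h => ?_) (fun h => ?_)⟩
  · exact strictMonoOn_of_hasDerivWithinAt_pos (convex_Icc _ _) hxcont hder
      fun l hl => h l (interior_subset hl)
  · exact strictAntiOn_of_hasDerivWithinAt_neg (convex_Icc _ _) hxcont hder
      fun l hl => h l (interior_subset hl)
end

section
/- The Eisenhart spacetime is causal: there is no closed future-directed causal curve, i.e. there is no future-directed causal C¹ curve x : [λ₀,λ₁] → M with λ₀ < λ₁ and x(λ₀) = x(λ₁). -/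
open Set

/-- A vector `V = (τ,v,υ)` is future-directed causal at `x` if `Q_x(V) ≤ 0` and
either `τ > 0`, or `τ = 0` and `υ > 0`. -/
def FDCausal {d : ℕ}
    (a : ℝ → (Fin d → ℝ) → (Fin d → ℝ) → (Fin d → ℝ) → ℝ)
    (b : ℝ → (Fin d → ℝ) → (Fin d → ℝ) → ℝ)
    (U ψ : ℝ → (Fin d → ℝ) → ℝ)
    (x V : ℝ × (Fin d → ℝ) × ℝ) : Prop :=
  eisG a b U ψ x V V ≤ 0 ∧ (0 < V.1 ∨ (V.1 = 0 ∧ 0 < V.2.2))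

/-- The Eisenhart spacetime is causal: there is no closed future-directed causal
C¹ curve. -/
theorem eisenhart_spacetime_is_causal (d : ℕ) (hd : 1 ≤ d)
    (a : ℝ → (Fin d → ℝ) → (Fin d → ℝ) → (Fin d → ℝ) → ℝ)
    (b : ℝ → (Fin d → ℝ) → (Fin d → ℝ) → ℝ)
    (U ψ : ℝ → (Fin d → ℝ) → ℝ)
    (hsymm : ∀ t q v w, a t q v w = a t q w v)
    (halin : ∀ t q w, IsLinearMap ℝ (fun v => a t q v w))
    (hapos : ∀ t q v, v ≠ 0 → 0 < a t q v v)
    (hblin : ∀ t q, IsLinearMap ℝ (b t q))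
    (hψpos : ∀ t q, 0 < ψ t q)
    (hareg : ∀ v w, ContDiff ℝ 1 (fun p : ℝ × (Fin d → ℝ) => a p.1 p.2 v w))
    (hbreg : ∀ v, ContDiff ℝ 1 (fun p : ℝ × (Fin d → ℝ) => b p.1 p.2 v))
    (hUreg : ContDiff ℝ 1 (fun p : ℝ × (Fin d → ℝ) => U p.1 p.2))
    (hψreg : ContDiff ℝ 1 (fun p : ℝ × (Fin d → ℝ) => ψ p.1 p.2))
    (lam₀ lam₁ : ℝ) (hlam : lam₀ < lam₁)
    (x x' : ℝ → ℝ × (Fin d → ℝ) × ℝ)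
    (hx : ∀ l ∈ Icc lam₀ lam₁, HasDerivWithinAt x (x' l) (Icc lam₀ lam₁) l)
    (hx' : ContinuousOn x' (Icc lam₀ lam₁))
    (hcausal : ∀ l ∈ Icc lam₀ lam₁, FDCausal a b U ψ (x l) (x' l)) :
    x lam₀ ≠ x lam₁ := by
  have ht : ∀ l ∈ Icc lam₀ lam₁,
      HasDerivWithinAt (fun l => (x l).1) (x' l).1 (Icc lam₀ lam₁) l :=
    fun l hl => (hasFDerivAt_fst.comp_hasDerivWithinAt l (hx l hl) :)
  have hy : ∀ l ∈ Icc lam₀ lam₁,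
      HasDerivWithinAt (fun l => (x l).2.2) (x' l).2.2 (Icc lam₀ lam₁) l :=
    fun l hl => (hasFDerivAt_snd.comp_hasDerivWithinAt l
      (hasFDerivAt_snd.comp_hasDerivWithinAt l (hx l hl)) :)
  have hmono : MonotoneOn (fun l => (x l).1) (Icc lam₀ lam₁) :=
    monotoneOn_of_hasDerivWithinAt_nonneg (convex_Icc _ _)
      (fun l hl => (ht l hl).continuousWithinAt)
      (fun l hl => (ht l (interior_subset hl)).mono interior_subset)
      (fun l hl => (hcausal l (interior_subset hl)).2.elim le_of_lt fun h => h.1.ge)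
  intro heq
  have h₀ : lam₀ ∈ Icc lam₀ lam₁ := left_mem_Icc.2 hlam.le
  have h₁ : lam₁ ∈ Icc lam₀ lam₁ := right_mem_Icc.2 hlam.le
  have hconst : ∀ l ∈ Icc lam₀ lam₁, (x l).1 = (x lam₀).1 := fun l hl =>
    le_antisymm ((hmono hl h₁ hl.2).trans_eq (congrArg Prod.fst heq.symm)) (hmono h₀ hl hl.1)
  have hτ : ∀ l ∈ Icc lam₀ lam₁, (x' l).1 = 0 := fun l hl =>
    (uniqueDiffOn_Icc hlam l hl).eq_deriv _ (ht l hl)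
      ((hasDerivWithinAt_const l _ (x lam₀).1).congr hconst (hconst l hl))
  have hυ : ∀ l ∈ Icc lam₀ lam₁, 0 < (x' l).2.2 := fun l hl =>
    (hcausal l hl).2.elim (fun h => absurd (hτ l hl) h.ne') fun h => h.2
  have hstrict : StrictMonoOn (fun l => (x l).2.2) (Icc lam₀ lam₁) :=
    strictMonoOn_of_hasDerivWithinAt_pos (convex_Icc _ _)
      (fun l hl => (hy l hl).continuousWithinAt)
      (fun l hl => (hy l (interior_subset hl)).mono interior_subset)
      (fun l hl => hυ l (interior_subset hl))
  exact (hstrict h₀ h₁ hlam).ne (congrArg (fun p => p.2.2) heq)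
end

section
/- Assume ψ ≡ 1 and that a, b, U are independent of t and of class C². Let x : [λ₀,λ₁] → M be a C² curve satisfying the Euler–Lagrange equations of the energy Lagrangian G(x,ẋ) = Q_x(ẋ), whose t-component satisfies t'(λ) > 0 for all λ. Then the classical energy λ ↦ ½·a(q(λ))( q'(λ)/t'(λ), q'(λ)/t'(λ) ) + U(q(λ)) is constant along x (conservation of energy on the reduced spacetime, due to the additional symmetry generated by ∂/∂t). -/
open Set

/-- Euler–Lagrange equations of a Lagrangian `G(x,ẋ)` along a curve. -/
def SatisfiesEL {P : Type*} [AddCommGroup P] [Module ℝ P]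
    (G : P → P → ℝ) (x x' : ℝ → P) (s : Set ℝ) : Prop :=
  ∀ e : P, ∀ l ∈ s,
    HasDerivWithinAt (fun m => deriv (fun h : ℝ => G (x m) (x' m + h • e)) 0)
      (deriv (fun h : ℝ => G (x l + h • e) (x' l)) 0) s l

theorem eq_of_hasDerivWithinAt_zero {f : ℝ → ℝ} {u v : ℝ}
    (hf : ∀ l ∈ Icc u v, HasDerivWithinAt f 0 (Icc u v) l) :
    ∀ l ∈ Icc u v, ∀ m ∈ Icc u v, f l = f m := by
  have key : ∀ l ∈ Icc u v, f l = f u := by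
    refine constant_of_derivWithin_zero (fun l hl => (hf l hl).differentiableWithinAt) ?_
    intro l hl
    have huv : u < v := hl.1.trans_lt hl.2
    exact (hf l (Ico_subset_Icc_self hl)).derivWithin
      (uniqueDiffOn_Icc huv l (Ico_subset_Icc_self hl))
  intro l hl m hm
  rw [key l hl, key m hm]

/-- A pointwise differentiable family of symmetric bilinear forms on a finite-dimensional space
is a differentiable map into continuous bilinear maps. -/
theorem exists_differentiable_bilin {E F : Type*} [NormedAddCommGroup E] [NormedSpace ℝ E]
    [NormedAddCommGroup F] [NormedSpace ℝ F] [FiniteDimensional ℝ F]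
    (a : E → F → F → ℝ) (hsymm : ∀ q v w, a q v w = a q w v)
    (halin : ∀ q w, IsLinearMap ℝ (fun v => a q v w))
    (hareg : ∀ v w, ContDiff ℝ 2 (fun q => a q v w)) :
    ∃ A : E → F →L[ℝ] F →L[ℝ] ℝ, Differentiable ℝ A ∧ ∀ q v w, a q v w = A q v w := by
  let A : E → F →L[ℝ] F →L[ℝ] ℝ := fun q =>
    LinearMap.toContinuousBilinearMap (LinearMap.mk₂ ℝ (a q)
      (fun v v' w => (halin q w).map_add v v')
      (fun c v w => (halin q w).map_smul c v)
      (fun v w w' => by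
        rw [hsymm q v, hsymm q v w, hsymm q v w']; exact (halin q v).map_add w w')
      (fun c v w => by
        rw [hsymm q v, hsymm q v w]; exact (halin q v).map_smul c w))
  have hA : ∀ q v w, a q v w = A q v w := fun q v w => rfl
  refine ⟨A, ?_, hA⟩
  have : ContDiff ℝ 2 A := by
    rw [contDiff_clm_apply_iff]
    intro v
    rw [contDiff_clm_apply_iff]
    intro w
    exact hareg v w
  exact this.differentiable (by norm_num)

/-- A pointwise differentiable family of linear forms on a finite-dimensional space is a
differentiable map into continuous linear forms. -/
theorem exists_differentiable_clm {E F : Type*} [NormedAddCommGroup E] [NormedSpace ℝ E]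
    [NormedAddCommGroup F] [NormedSpace ℝ F] [FiniteDimensional ℝ F]
    (b : E → F → ℝ) (hblin : ∀ q, IsLinearMap ℝ (b q))
    (hbreg : ∀ v, ContDiff ℝ 2 (fun q => b q v)) :
    ∃ B : E → F →L[ℝ] ℝ, Differentiable ℝ B ∧ ∀ q v, b q v = B q v := by
  let B : E → F →L[ℝ] ℝ := fun q => LinearMap.toContinuousLinearMap ((hblin q).mk' (b q))
  refine ⟨B, ?_, fun q v => rfl⟩
  have : ContDiff ℝ 2 B := by
    rw [contDiff_clm_apply_iff]
    exact hbreg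
  exact this.differentiable (by norm_num)

theorem Differentiable.hasDerivWithinAt_comp {E G : Type*} [NormedAddCommGroup E]
    [NormedSpace ℝ E] [NormedAddCommGroup G] [NormedSpace ℝ G] {A : E → G}
    (hA : Differentiable ℝ A) {q : ℝ → E} {v : E} {s : Set ℝ} {l : ℝ}
    (hq : HasDerivWithinAt q v s l) :
    HasDerivWithinAt (fun m => A (q m)) (fderiv ℝ A (q l) v) s l :=
  (hA (q l)).hasFDerivAt.comp_hasDerivWithinAt l hq

theorem Differentiable.hasDerivAt_add_smul {E G : Type*} [NormedAddCommGroup E]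
    [NormedSpace ℝ E] [NormedAddCommGroup G] [NormedSpace ℝ G] {A : E → G}
    (hA : Differentiable ℝ A) (q w : E) :
    HasDerivAt (fun h : ℝ => A (q + h • w)) (fderiv ℝ A q w) 0 := by
  have h0 : HasDerivAt (fun h : ℝ => q + h • w) w 0 := by
    simpa using ((hasDerivAt_id (0 : ℝ)).smul_const w).const_add q
  exact (hA q).hasFDerivAt.comp_hasDerivAt_of_eq (0 : ℝ) h0 (by simp)

theorem HasDerivWithinAt.bilin_apply {E : Type*} [NormedAddCommGroup E] [NormedSpace ℝ E]
    {Φ : ℝ → E →L[ℝ] E →L[ℝ] ℝ} {Φ' : E →L[ℝ] E →L[ℝ] ℝ} {v w : ℝ → E} {v' w' : E}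
    {s : Set ℝ} {l : ℝ} (hΦ : HasDerivWithinAt Φ Φ' s l) (hv : HasDerivWithinAt v v' s l)
    (hw : HasDerivWithinAt w w' s l) :
    HasDerivWithinAt (fun m => Φ m (v m) (w m))
      (Φ' (v l) (w l) + Φ l v' (w l) + Φ l (v l) w') s l := by
  simpa using (hΦ.clm_apply hv).clm_apply hw

/-- Along an affinely parametrized geodesic of a time-independent Eisenhart metric with `ψ ≡ 1`,
both `t'` and `t'² · (a(q'/t', q'/t') + 2 U)` have vanishing derivative. -/
theorem hasDerivWithinAt_zero_of_satisfiesEL {E : Type*} [NormedAddCommGroup E] [NormedSpace ℝ E]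
    {A : E → E →L[ℝ] E →L[ℝ] ℝ} {B : E → E →L[ℝ] ℝ} {U : E → ℝ}
    (hA : Differentiable ℝ A) (hB : Differentiable ℝ B) (hU : Differentiable ℝ U)
    (hsymm : ∀ q v w, A q v w = A q w v) {lam₀ lam₁ : ℝ} (hlam : lam₀ < lam₁)
    {x x' x'' : ℝ → ℝ × E × ℝ}
    (hx : ∀ l ∈ Icc lam₀ lam₁, HasDerivWithinAt x (x' l) (Icc lam₀ lam₁) l)
    (hx' : ∀ l ∈ Icc lam₀ lam₁, HasDerivWithinAt x' (x'' l) (Icc lam₀ lam₁) l)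
    (hEL : SatisfiesEL (fun p V : ℝ × E × ℝ => A p.2.1 V.2.1 V.2.1
        - 1 * (V.1 * (V.2.2 - B p.2.1 V.2.1) + V.1 * (V.2.2 - B p.2.1 V.2.1))
        - (2 * U p.2.1 + 1) * 1 ^ 2 * V.1 * V.1) x x' (Icc lam₀ lam₁)) :
    (∀ l ∈ Icc lam₀ lam₁, HasDerivWithinAt (fun m => (x' m).1) 0 (Icc lam₀ lam₁) l) ∧
    ∀ l ∈ Icc lam₀ lam₁, HasDerivWithinAt
      (fun m => A (x m).2.1 (x' m).2.1 (x' m).2.1 + 2 * ((x' m).1 ^ 2 * U (x m).2.1)) 0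
      (Icc lam₀ lam₁) l := by
  simp only [SatisfiesEL] at hEL
  have hud : UniqueDiffOn ℝ (Icc lam₀ lam₁) := uniqueDiffOn_Icc hlam
  have hq : ∀ l ∈ Icc lam₀ lam₁,
      HasDerivWithinAt (fun m => (x m).2.1) (x' l).2.1 (Icc lam₀ lam₁) l :=
    fun l hl => (hx l hl).snd.fst
  have hv : ∀ l ∈ Icc lam₀ lam₁,
      HasDerivWithinAt (fun m => (x' m).2.1) (x'' l).2.1 (Icc lam₀ lam₁) l :=
    fun l hl => (hx' l hl).snd.fst
  have hτ : ∀ l ∈ Icc lam₀ lam₁,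
      HasDerivWithinAt (fun m => (x' m).1) 0 (Icc lam₀ lam₁) l := by
    intro l hl
    have h := hEL (0, 0, 1) l hl
    simp only [Prod.fst_add, Prod.snd_add, Prod.smul_fst, Prod.smul_snd, smul_zero, add_zero,
      deriv_const, smul_eq_mul, mul_one, mul_zero] at h
    have hp : ∀ m, deriv (fun h : ℝ => A (x m).2.1 (x' m).2.1 (x' m).2.1
        - 1 * ((x' m).1 * ((x' m).2.2 + h - B (x m).2.1 (x' m).2.1)
          + (x' m).1 * ((x' m).2.2 + h - B (x m).2.1 (x' m).2.1))
        - (2 * U (x m).2.1 + 1) * 1 ^ 2 * (x' m).1 * (x' m).1) 0 = -2 * (x' m).1 := by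
      intro m
      have h1 : HasDerivAt (fun h : ℝ =>
          (x' m).1 * ((x' m).2.2 + h - B (x m).2.1 (x' m).2.1)) ((x' m).1 * 1) 0 :=
        (((hasDerivAt_id (0 : ℝ)).const_add _).sub_const _).const_mul _
      have h2 := (((h1.add h1).const_mul 1).const_sub
        (A (x m).2.1 (x' m).2.1 (x' m).2.1)).sub_const
          ((2 * U (x m).2.1 + 1) * 1 ^ 2 * (x' m).1 * (x' m).1)
      refine h2.deriv.trans ?_
      ring
    simp only [one_pow, mul_one] at h hp
    simp only [hp] at h
    have h3 := h.const_mul (-1 / 2 : ℝ)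
    refine (h3.congr_deriv (by simp)).congr_of_mem (fun m _ => by ring) hl
  refine ⟨hτ, ?_⟩
  intro l hl
  set w := (x' l).2.1 with hw
  have hAq : HasDerivWithinAt (fun m => A (x m).2.1) (fderiv ℝ A (x l).2.1 w)
      (Icc lam₀ lam₁) l :=
    Differentiable.hasDerivWithinAt_comp (A := A) hA (hq l hl)
  have hBq : HasDerivWithinAt (fun m => B (x m).2.1) (fderiv ℝ B (x l).2.1 w)
      (Icc lam₀ lam₁) l :=
    hB.hasDerivWithinAt_comp (hq l hl)
  have hUq : HasDerivWithinAt (fun m => U (x m).2.1) (fderiv ℝ U (x l).2.1 w)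
      (Icc lam₀ lam₁) l :=
    hU.hasDerivWithinAt_comp (hq l hl)
  have h := hEL (0, w, 0) l hl
  have hp : ∀ m, deriv (fun h : ℝ =>
      A (x m).2.1 (x' m + h • ((0, w, 0) : ℝ × E × ℝ)).2.1
          (x' m + h • ((0, w, 0) : ℝ × E × ℝ)).2.1
      - 1 * ((x' m + h • ((0, w, 0) : ℝ × E × ℝ)).1
          * ((x' m + h • ((0, w, 0) : ℝ × E × ℝ)).2.2
            - B (x m).2.1 (x' m + h • ((0, w, 0) : ℝ × E × ℝ)).2.1)
        + (x' m + h • ((0, w, 0) : ℝ × E × ℝ)).1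
          * ((x' m + h • ((0, w, 0) : ℝ × E × ℝ)).2.2
            - B (x m).2.1 (x' m + h • ((0, w, 0) : ℝ × E × ℝ)).2.1))
      - (2 * U (x m).2.1 + 1) * 1 ^ 2 * (x' m + h • ((0, w, 0) : ℝ × E × ℝ)).1
        * (x' m + h • ((0, w, 0) : ℝ × E × ℝ)).1) 0
      = 2 * A (x m).2.1 (x' m).2.1 w + 2 * ((x' m).1 * B (x m).2.1 w) := by
    intro m
    simp only [Prod.fst_add, Prod.snd_add, Prod.smul_fst, Prod.smul_snd, smul_zero, add_zero]
    have h0 : HasDerivAt (fun h : ℝ => (x' m).2.1 + h • w) w 0 := by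
      simpa using ((hasDerivAt_id (0 : ℝ)).smul_const w).const_add (x' m).2.1
    have h1 := ((A (x m).2.1).hasFDerivAt.comp_hasDerivAt (0 : ℝ) h0).clm_apply h0
    have h2 := ((((B (x m).2.1).hasFDerivAt.comp_hasDerivAt (0 : ℝ) h0).const_sub
      (x' m).2.2).const_mul (x' m).1)
    have h3 := (h1.sub ((h2.add h2).const_mul 1)).sub_const
      ((2 * U (x m).2.1 + 1) * 1 ^ 2 * (x' m).1 * (x' m).1)
    refine h3.deriv.trans ?_
    simp only [Function.comp_apply, zero_smul, add_zero]
    rw [hsymm _ w]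
    ring
  have hr : deriv (fun h : ℝ =>
      A (x l + h • ((0, w, 0) : ℝ × E × ℝ)).2.1 w w
      - 1 * ((x' l).1 * ((x' l).2.2
            - B (x l + h • ((0, w, 0) : ℝ × E × ℝ)).2.1 w)
        + (x' l).1 * ((x' l).2.2
            - B (x l + h • ((0, w, 0) : ℝ × E × ℝ)).2.1 w))
      - (2 * U (x l + h • ((0, w, 0) : ℝ × E × ℝ)).2.1 + 1) * 1 ^ 2
        * (x' l).1 * (x' l).1) 0
      = fderiv ℝ A (x l).2.1 w w w + 2 * ((x' l).1 * fderiv ℝ B (x l).2.1 w w)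
        - 2 * ((x' l).1 ^ 2 * fderiv ℝ U (x l).2.1 w) := by
    simp only [Prod.snd_add, Prod.fst_add, Prod.smul_fst, Prod.smul_snd]
    have hA0 : HasDerivAt (fun h : ℝ => A ((x l).2.1 + h • w) w w)
        (fderiv ℝ A (x l).2.1 w w w) 0 := by
      have h1 := (Differentiable.hasDerivAt_add_smul (A := A) hA (x l).2.1 w).hasDerivWithinAt
        (s := univ)
      have h2 := h1.bilin_apply (hasDerivWithinAt_const 0 univ w) (hasDerivWithinAt_const 0 univ w)
      simpa using h2
    have hB0 : HasDerivAt
        (fun h : ℝ => (x' l).1 * ((x' l).2.2 - B ((x l).2.1 + h • w) w))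
        ((x' l).1 * -(fderiv ℝ B (x l).2.1 w w)) 0 := by
      have h1 := (hB.hasDerivAt_add_smul (x l).2.1 w).clm_apply (hasDerivAt_const (0 : ℝ) w)
      simpa using (h1.const_sub (x' l).2.2).const_mul (x' l).1
    have hU0 := (((((hU.hasDerivAt_add_smul (x l).2.1 w).const_mul
      2).add_const 1).mul_const (1 ^ 2)).mul_const (x' l).1).mul_const (x' l).1
    refine ((hA0.sub ((hB0.add hB0).const_mul 1)).sub hU0).deriv.trans ?_
    ring
  rw [hr] at h
  simp only [hp] at h
  have hmom := (hAq.bilin_apply (hv l hl)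
    (hasDerivWithinAt_const l (Icc lam₀ lam₁) w)).const_mul 2 |>.add
    (((hτ l hl).mul (hBq.clm_apply (hasDerivWithinAt_const l (Icc lam₀ lam₁) w))).const_mul 2)
  have heq := (hud l hl).eq_deriv _ h hmom
  have hen := (hAq.bilin_apply (hv l hl) (hv l hl)).add
    ((((hτ l hl).pow 2).mul hUq).const_mul 2)
  refine hen.congr_deriv ?_
  simp only [Pi.pow_apply, map_zero, add_zero, zero_mul, mul_zero, zero_add, ← hw] at heq ⊢
  rw [hsymm _ w]
  linarith

/-- Conservation of the classical energy `½·a(q'/t', q'/t') + U(q)` along geodesics of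
the Eisenhart metric with `ψ ≡ 1` and time-independent `a`, `b`, `U` (the additional
symmetry generated by `∂/∂t`). -/
theorem conservation_of_classical_energy (d : ℕ) (hd : 1 ≤ d)
    (a : (Fin d → ℝ) → (Fin d → ℝ) → (Fin d → ℝ) → ℝ)
    (b : (Fin d → ℝ) → (Fin d → ℝ) → ℝ)
    (U : (Fin d → ℝ) → ℝ)
    (hsymm : ∀ q v w, a q v w = a q w v)
    (halin : ∀ q w, IsLinearMap ℝ (fun v => a q v w))
    (hapos : ∀ q v, v ≠ 0 → 0 < a q v v)
    (hblin : ∀ q, IsLinearMap ℝ (b q))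
    (hareg : ∀ v w, ContDiff ℝ 2 (fun q : Fin d → ℝ => a q v w))
    (hbreg : ∀ v, ContDiff ℝ 2 (fun q : Fin d → ℝ => b q v))
    (hUreg : ContDiff ℝ 2 U)
    (lam₀ lam₁ : ℝ) (hlam : lam₀ < lam₁)
    (x x' x'' : ℝ → ℝ × (Fin d → ℝ) × ℝ)
    (hx : ∀ l ∈ Icc lam₀ lam₁, HasDerivWithinAt x (x' l) (Icc lam₀ lam₁) l)
    (hx' : ∀ l ∈ Icc lam₀ lam₁, HasDerivWithinAt x' (x'' l) (Icc lam₀ lam₁) l)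
    (hx'' : ContinuousOn x'' (Icc lam₀ lam₁))
    (htpos : ∀ l ∈ Icc lam₀ lam₁, 0 < (x' l).1)
    (hEL : SatisfiesEL
      (fun p V => eisG (fun _ q => a q) (fun _ q => b q) (fun _ q => U q)
        (fun _ _ => 1) p V V) x x' (Icc lam₀ lam₁)) :
    ∀ l ∈ Icc lam₀ lam₁, ∀ m ∈ Icc lam₀ lam₁,
      (1 / 2) * a ((x l).2.1) (((x' l).1)⁻¹ • (x' l).2.1) (((x' l).1)⁻¹ • (x' l).2.1)
          + U ((x l).2.1)
        = (1 / 2) * a ((x m).2.1) (((x' m).1)⁻¹ • (x' m).2.1) (((x' m).1)⁻¹ • (x' m).2.1)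
          + U ((x m).2.1) := by
  obtain ⟨A, hA, haA⟩ := exists_differentiable_bilin a hsymm halin hareg
  obtain ⟨B, hB, hbB⟩ := exists_differentiable_clm b hblin hbreg
  have hU : Differentiable ℝ U := hUreg.differentiable (by norm_num)
  simp only [haA] at hsymm ⊢
  simp only [eisG, haA, hbB] at hEL
  obtain ⟨hτ, hE⟩ := hasDerivWithinAt_zero_of_satisfiesEL hA hB hU hsymm hlam hx hx' hEL
  intro l hl m hm
  have h1 := eq_of_hasDerivWithinAt_zero hE l hl m hm
  have h2 := eq_of_hasDerivWithinAt_zero hτ l hl m hm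
  have h3 := (htpos m hm).ne'
  simp only [map_smul, _root_.smul_apply, smul_eq_mul]
  simp only [h2] at h1 ⊢
  field_simp
  linarith
end

section
/- (Causal Eisenhart theorem.) Assume a, b, 𝒰 are C². Fix c ≥ 0, t₀ < t₁ and y₀ ∈ ℝ. Let q : [t₀,t₁] → ℝ^d be C², define y(t) = y₀ + ∫_{t₀}^{t} ( ½·a(s,q(s))(q'(s),q'(s)) + b(s,q(s))(q'(s)) − 𝒰(s,q(s)) + c ) ds and x(t) = (t, q(t), y(t)) (the lift of q). Then: (1) Q_{x(t)}(x'(t)) = −2c and g_{x(t)}(n,x'(t)) = −1 for all t, so x is timelike if c > 0 and lightlike if c = 0; (2) q satisfies the Euler–Lagrange equations of the classical Lagrangian L(t,q,q̇) = ½·a(t,q)(q̇,q̇) + b(t,q)(q̇) − 𝒰(t,q) if and only if x satisfies the Euler–Lagrange equations of the energy Lagrangian G(x,ẋ) = Q_x(ẋ) with t as curve parameter, i.e. if and only if x is an affinely parametrized causal geodesic of the Eisenhart metric. -/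
open Set

/-- The Eisenhart metric in Bargmann form on `M = ℝ × (Fin d → ℝ) × ℝ`:
`g_x(V,V') = a(t,q)(v,v') − τ(υ'−b v') − τ'(υ−b v) − 2𝒰ττ'`. -/
noncomputable def barG {d : ℕ}
    (a : ℝ → (Fin d → ℝ) → (Fin d → ℝ) → (Fin d → ℝ) → ℝ)
    (b : ℝ → (Fin d → ℝ) → (Fin d → ℝ) → ℝ)
    (𝒰 : ℝ → (Fin d → ℝ) → ℝ)
    (x V V' : ℝ × (Fin d → ℝ) × ℝ) : ℝ :=
  a x.1 x.2.1 V.2.1 V'.2.1 - V.1 * (V'.2.2 - b x.1 x.2.1 V'.2.1)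
    - V'.1 * (V.2.2 - b x.1 x.2.1 V.2.1) - 2 * 𝒰 x.1 x.2.1 * V.1 * V'.1

/-- The classical Lagrangian `L(t,q,q̇) = ½ a(t,q)(q̇,q̇) + b(t,q)(q̇) − 𝒰(t,q)`. -/
noncomputable def classicalLag {d : ℕ}
    (a : ℝ → (Fin d → ℝ) → (Fin d → ℝ) → (Fin d → ℝ) → ℝ)
    (b : ℝ → (Fin d → ℝ) → (Fin d → ℝ) → ℝ)
    (𝒰 : ℝ → (Fin d → ℝ) → ℝ)
    (t : ℝ) (p v : Fin d → ℝ) : ℝ :=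
  (1 / 2) * a t p v v + b t p v - 𝒰 t p

/-- Euler–Lagrange equations of a classical Lagrangian `L(t,q,q̇)` along a curve. -/
def SatisfiesELClassical {d : ℕ}
    (L : ℝ → (Fin d → ℝ) → (Fin d → ℝ) → ℝ) (q q' : ℝ → Fin d → ℝ) (s : Set ℝ) : Prop :=
  ∀ e : Fin d → ℝ, ∀ t ∈ s,
    HasDerivWithinAt (fun u => deriv (fun h : ℝ => L u (q u) (q' u + h • e)) 0)
      (deriv (fun h : ℝ => L t (q t + h • e) (q' t)) 0) s t

/-- Energy balance: along a solution of the Euler–Lagrange equations of `F`, the energy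
`∂F/∂v · q' − F` has derivative `−∂F/∂t`. -/
lemma hasDerivWithinAt_energy {d : ℕ} {F : ℝ × (Fin d → ℝ) × (Fin d → ℝ) → ℝ}
    (hF : Differentiable ℝ F) {q q' : ℝ → Fin d → ℝ} {w : Fin d → ℝ} {s : Set ℝ} {t : ℝ}
    (hq : HasDerivWithinAt q (q' t) s t) (hq' : HasDerivWithinAt q' w s t)
    (hEL : ∀ e, HasDerivWithinAt (fun m => fderiv ℝ F (m, q m, q' m) (0, 0, e))
      (fderiv ℝ F (t, q t, q' t) (0, e, 0)) s t) :
    HasDerivWithinAt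
      (fun m => fderiv ℝ F (m, q m, q' m) (0, 0, q' m) - F (m, q m, q' m))
      (-fderiv ℝ F (t, q t, q' t) (1, 0, 0)) s t := by
  have hsum (z : ℝ × (Fin d → ℝ) × (Fin d → ℝ))
      (f : (Fin d → ℝ) →ₗ[ℝ] ℝ × (Fin d → ℝ) × (Fin d → ℝ)) (v : Fin d → ℝ) : fderiv ℝ F z (f v) =
        ∑ i, v i * fderiv ℝ F z (f fun j => if i = j then 1 else 0) := by
    simpa using LinearMap.pi_apply_eq_sum_univ ((fderiv ℝ F z).toLinearMap ∘ₗ f) v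
  have hinr (z : ℝ × (Fin d → ℝ) × (Fin d → ℝ)) (v : Fin d → ℝ) :
      fderiv ℝ F z (0, 0, v) =
        ∑ i, v i * fderiv ℝ F z (0, 0, fun j => if i = j then 1 else 0) :=
    hsum z (LinearMap.inr ℝ _ _ ∘ₗ LinearMap.inr ℝ _ _) v
  have hinl (z : ℝ × (Fin d → ℝ) × (Fin d → ℝ)) (v : Fin d → ℝ) :
      fderiv ℝ F z (0, v, 0) =
        ∑ i, v i * fderiv ℝ F z (0, (fun j => if i = j then 1 else 0), 0) :=
    hsum z (LinearMap.inr ℝ _ _ ∘ₗ LinearMap.inl ℝ _ _) v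
  have hcurve : HasDerivWithinAt (fun m => F (m, q m, q' m))
      (fderiv ℝ F (t, q t, q' t) (1, q' t, w)) s t :=
    (hF (t, q t, q' t)).hasFDerivAt.comp_hasDerivWithinAt (f := fun m => (m, q m, q' m)) t
      ((hasDerivWithinAt_id t s).prodMk (hq.prodMk hq'))
  have hmom : HasDerivWithinAt (fun m => fderiv ℝ F (m, q m, q' m) (0, 0, q' m))
      (fderiv ℝ F (t, q t, q' t) (0, 0, w) + fderiv ℝ F (t, q t, q' t) (0, q' t, 0)) s t := by
    rw [hinr _ w, hinl _ (q' t), ← Finset.sum_add_distrib,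
      funext fun m => hinr (m, q m, q' m) (q' m)]
    exact HasDerivWithinAt.fun_sum fun i _ => (hasDerivWithinAt_pi.1 hq' i).mul (hEL _)
  refine (hmom.sub hcurve).congr_deriv ?_
  have hsplit : ((1, q' t, w) : ℝ × (Fin d → ℝ) × (Fin d → ℝ)) =
      (1, 0, 0) + (0, q' t, 0) + (0, 0, w) := by simp
  rw [hsplit, map_add, map_add]
  ring

lemma differentiable_classicalLag {d : ℕ}
    {a : ℝ → (Fin d → ℝ) → (Fin d → ℝ) → (Fin d → ℝ) → ℝ}
    {b : ℝ → (Fin d → ℝ) → (Fin d → ℝ) → ℝ} {𝒰 : ℝ → (Fin d → ℝ) → ℝ}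
    (hsymm : ∀ t q v w, a t q v w = a t q w v)
    (halin : ∀ t q w, IsLinearMap ℝ (fun v => a t q v w))
    (hblin : ∀ t q, IsLinearMap ℝ (b t q))
    (ha : ∀ v w, Differentiable ℝ (fun p : ℝ × (Fin d → ℝ) => a p.1 p.2 v w))
    (hb : ∀ v, Differentiable ℝ (fun p : ℝ × (Fin d → ℝ) => b p.1 p.2 v))
    (hU : Differentiable ℝ (fun p : ℝ × (Fin d → ℝ) => 𝒰 p.1 p.2)) :
    Differentiable ℝ (fun z : ℝ × (Fin d → ℝ) × (Fin d → ℝ) =>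
      classicalLag a b 𝒰 z.1 z.2.1 z.2.2) := by
  have hasum (t : ℝ) (p v w : Fin d → ℝ) :
      a t p v w = ∑ i, v i * a t p (fun j => if i = j then 1 else 0) w :=
    LinearMap.pi_apply_eq_sum_univ ((halin t p w).mk' _) v
  have hbsum (t : ℝ) (p v : Fin d → ℝ) :
      b t p v = ∑ i, v i * b t p (fun j => if i = j then 1 else 0) :=
    LinearMap.pi_apply_eq_sum_univ ((hblin t p).mk' _) v
  have hexp (t : ℝ) (p v : Fin d → ℝ) : classicalLag a b 𝒰 t p v =
      (1 / 2) * (∑ i, v i * ∑ k, v k *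
        a t p (fun j => if k = j then 1 else 0) (fun j => if i = j then 1 else 0))
      + (∑ i, v i * b t p (fun j => if i = j then 1 else 0)) - 𝒰 t p := by
    rw [classicalLag, hasum, hbsum]
    congr! 5 with i
    rw [hsymm, hasum]
  have hproj : Differentiable ℝ
      (fun z : ℝ × (Fin d → ℝ) × (Fin d → ℝ) => (z.1, z.2.1)) := by fun_prop
  have ha' (v w : Fin d → ℝ) : Differentiable ℝ
      (fun z : ℝ × (Fin d → ℝ) × (Fin d → ℝ) => a z.1 z.2.1 v w) := (ha v w).comp hproj
  have hb' (v : Fin d → ℝ) : Differentiable ℝ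
      (fun z : ℝ × (Fin d → ℝ) × (Fin d → ℝ) => b z.1 z.2.1 v) := (hb v).comp hproj
  have hU' : Differentiable ℝ
      (fun z : ℝ × (Fin d → ℝ) × (Fin d → ℝ) => 𝒰 z.1 z.2.1) := hU.comp hproj
  simp_rw [hexp]
  fun_prop

lemma deriv_eq_of_quadratic {f : ℝ → ℝ} (A B C : ℝ) (hf : ∀ h, f h = A + h * B + h ^ 2 * C) :
    deriv f 0 = B := by
  rw [funext hf]
  have h := (((hasDerivAt_id (0 : ℝ)).mul_const B).const_add A).add
    (((hasDerivAt_id (0 : ℝ)).pow 2).mul_const C)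
  exact (h.congr_deriv (by simp)).deriv

lemma deriv_line {P : Type*} [NormedAddCommGroup P] [NormedSpace ℝ P] {F : P → ℝ}
    (hF : Differentiable ℝ F) (z e : P) :
    deriv (fun h : ℝ => F (z + h • e)) 0 = fderiv ℝ F z e :=
  (hF z).lineDeriv_eq_fderiv

/-- Causal Eisenhart theorem: the `1/μ`-lift (with `2c = 1/μ²`)
`x(t) = (t, q(t), y₀ + ∫ (L + c))` of a curve `q` is a causal curve with
`Q(x') = −2c` and `g(n,x') = −1`, and `q` solves the classical Euler–Lagrange
equations iff `x` is an affinely parametrized causal geodesic of the Eisenhart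
metric (timelike for `c > 0`, lightlike for `c = 0`). -/
theorem causal_eisenhart_theorem (d : ℕ) (hd : 1 ≤ d)
    (a : ℝ → (Fin d → ℝ) → (Fin d → ℝ) → (Fin d → ℝ) → ℝ)
    (b : ℝ → (Fin d → ℝ) → (Fin d → ℝ) → ℝ)
    (𝒰 : ℝ → (Fin d → ℝ) → ℝ)
    (hsymm : ∀ t q v w, a t q v w = a t q w v)
    (halin : ∀ t q w, IsLinearMap ℝ (fun v => a t q v w))
    (hapos : ∀ t q v, v ≠ 0 → 0 < a t q v v)
    (hblin : ∀ t q, IsLinearMap ℝ (b t q))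
    (hareg : ∀ v w, ContDiff ℝ 2 (fun p : ℝ × (Fin d → ℝ) => a p.1 p.2 v w))
    (hbreg : ∀ v, ContDiff ℝ 2 (fun p : ℝ × (Fin d → ℝ) => b p.1 p.2 v))
    (hUreg : ContDiff ℝ 2 (fun p : ℝ × (Fin d → ℝ) => 𝒰 p.1 p.2))
    (c : ℝ) (hc : 0 ≤ c) (t₀ t₁ : ℝ) (ht : t₀ < t₁) (y₀ : ℝ)
    (q q' q'' : ℝ → Fin d → ℝ)
    (hq : ∀ t ∈ Icc t₀ t₁, HasDerivWithinAt q (q' t) (Icc t₀ t₁) t)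
    (hq' : ∀ t ∈ Icc t₀ t₁, HasDerivWithinAt q' (q'' t) (Icc t₀ t₁) t)
    (hq'' : ContinuousOn q'' (Icc t₀ t₁))
    (y : ℝ → ℝ)
    (hy : y = fun t => y₀ + ∫ s in t₀..t, (classicalLag a b 𝒰 s (q s) (q' s) + c))
    (x x' : ℝ → ℝ × (Fin d → ℝ) × ℝ)
    (hxdef : x = fun t => (t, q t, y t))
    (hx'def : x' = fun t => (1, q' t, classicalLag a b 𝒰 t (q t) (q' t) + c)) :
    (∀ t ∈ Icc t₀ t₁,
        barG a b 𝒰 (x t) (x' t) (x' t) = -2 * c ∧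
        barG a b 𝒰 (x t) ((0, 0, 1) : ℝ × (Fin d → ℝ) × ℝ) (x' t) = -1) ∧
    (SatisfiesELClassical (classicalLag a b 𝒰) q q' (Icc t₀ t₁) ↔
      SatisfiesEL (fun p V => barG a b 𝒰 p V V) x x' (Icc t₀ t₁)) := by
  have hadd (t : ℝ) (p u v w : Fin d → ℝ) : a t p (u + v) w = a t p u w + a t p v w :=
    (halin t p w).map_add u v
  have hsmul (t r : ℝ) (p v w : Fin d → ℝ) : a t p (r • v) w = r * a t p v w :=
    (halin t p w).map_smul r v
  have hadd' (t : ℝ) (p u v w : Fin d → ℝ) : a t p w (u + v) = a t p w u + a t p w v := by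
    simp only [hsymm t p w, hadd]
  have hsmul' (t r : ℝ) (p v w : Fin d → ℝ) : a t p w (r • v) = r * a t p w v := by
    simp only [hsymm t p w, hsmul]
  have hbadd (t : ℝ) (p u v : Fin d → ℝ) : b t p (u + v) = b t p u + b t p v :=
    (hblin t p).map_add u v
  have hbsmul (t r : ℝ) (p v : Fin d → ℝ) : b t p (r • v) = r * b t p v :=
    (hblin t p).map_smul r v
  have hb0 (t : ℝ) (p : Fin d → ℝ) : b t p 0 = 0 := (hblin t p).map_zero
  have ha0 (t : ℝ) (p w : Fin d → ℝ) : a t p 0 w = 0 := (halin t p w).map_zero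
  set F : ℝ × (Fin d → ℝ) × (Fin d → ℝ) → ℝ :=
    fun z => classicalLag a b 𝒰 z.1 z.2.1 z.2.2 with hFdef
  have hF : Differentiable ℝ F := differentiable_classicalLag hsymm halin hblin
    (fun v w => (hareg v w).differentiable (by norm_num))
    (fun v => (hbreg v).differentiable (by norm_num)) (hUreg.differentiable (by norm_num))
  have hmom (t : ℝ) (p v e : Fin d → ℝ) :
      deriv (fun h : ℝ => classicalLag a b 𝒰 t p (v + h • e)) 0 = a t p v e + b t p e := by
    refine deriv_eq_of_quadratic (classicalLag a b 𝒰 t p v) _ ((1 / 2) * a t p e e) fun h => ?_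
    simp only [classicalLag, hadd, hadd', hsmul, hsmul', hbadd, hbsmul, hsymm t p e v]
    ring
  have hmomF (t : ℝ) (p v e : Fin d → ℝ) :
      deriv (fun h : ℝ => classicalLag a b 𝒰 t p (v + h • e)) 0
        = fderiv ℝ F (t, p, v) (0, 0, e) := by
    simpa [hFdef] using deriv_line hF (t, p, v) (0, 0, e)
  have hforce (t : ℝ) (p v e : Fin d → ℝ) :
      deriv (fun h : ℝ => classicalLag a b 𝒰 t (p + h • e) v) 0
        = fderiv ℝ F (t, p, v) (0, e, 0) := by
    simpa [hFdef] using deriv_line hF (t, p, v) (0, e, 0)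
  have hmomG (t : ℝ) (e : ℝ × (Fin d → ℝ) × ℝ) :
      deriv (fun h : ℝ => barG a b 𝒰 (x t) (x' t + h • e) (x' t + h • e)) 0 =
        2 * fderiv ℝ F (t, q t, q' t) (0, 0, e.2.1)
        - 2 * e.1 * (fderiv ℝ F (t, q t, q' t) (0, 0, q' t) - F (t, q t, q' t) + c)
        - 2 * e.2.2 := by
    obtain ⟨e₀, e₁, e₂⟩ := e
    refine deriv_eq_of_quadratic (-2 * c) _ (barG a b 𝒰 (x t) (e₀, e₁, e₂) (e₀, e₁, e₂))
      fun h => ?_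
    rw [← hmomF, ← hmomF, hmom, hmom]
    simp only [hFdef, hxdef, hx'def, barG, classicalLag, Prod.fst_add, Prod.snd_add, Prod.smul_fst,
      Prod.smul_snd, smul_eq_mul, hadd, hadd', hsmul, hsmul', hbadd, hbsmul,
      hsymm t (q t) e₁ (q' t)]
    ring
  have hforceG (t : ℝ) (e : ℝ × (Fin d → ℝ) × ℝ) :
      deriv (fun h : ℝ => barG a b 𝒰 (x t + h • e) (x' t) (x' t)) 0 =
        2 * fderiv ℝ F (t, q t, q' t) (e.1, e.2.1, 0) := by
    have hline := deriv_line hF (t, q t, q' t) (e.1, e.2.1, 0)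
    have hbar : (fun h : ℝ => barG a b 𝒰 (x t + h • e) (x' t) (x' t)) = fun h : ℝ =>
        2 * F ((t, q t, q' t) + h • (e.1, e.2.1, 0)) - 2 * (F (t, q t, q' t) + c) := by
      funext h
      simp only [hFdef, hxdef, hx'def, barG, classicalLag, Prod.fst_add, Prod.snd_add,
        Prod.smul_fst, Prod.smul_snd, smul_zero, add_zero]
      ring
    rw [hbar, deriv_sub_const, deriv_const_mul_field, hline]
  refine ⟨fun t _ => ⟨?_, ?_⟩, fun h e t ht => ?_, fun h e t ht => ?_⟩
  · simp only [hxdef, hx'def, barG, classicalLag]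
    ring
  · simp [hxdef, hx'def, barG, ha0, hb0]
  · simp only [hmomG, hforceG]
    simp only [SatisfiesELClassical, hmomF, hforce] at h
    have henergy := hasDerivWithinAt_energy hF (hq t ht) (hq' t ht) fun e => h e t ht
    refine ((((h e.2.1 t ht).const_mul 2).sub
      ((henergy.add_const c).const_mul (2 * e.1))).sub_const (2 * e.2.2)).congr_deriv ?_
    have hsplit : ((e.1, e.2.1, 0) : ℝ × (Fin d → ℝ) × (Fin d → ℝ)) =
        e.1 • (1, 0, 0) + (0, e.2.1, 0) := by simp
    rw [hsplit, map_add, map_smul, smul_eq_mul]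
    ring
  · have hlift := h (0, e, 0) t ht
    simp only [hmomG, hforceG] at hlift
    simp only [hmomF, hforce]
    simpa using hlift.const_mul (2⁻¹ : ℝ)
end

section
/- Assume a, b, 𝒰 are C². Let x : [λ₀,λ₁] → M be a C² curve satisfying the Euler–Lagrange equations of the energy Lagrangian G(x,ẋ) = Q_x(ẋ), with Q_{x(λ)}(x'(λ)) = 0 for all λ (a lightlike geodesic) and with x'(λ₀) not a scalar multiple of n. Then the derivative t'(λ) of the t-component is a nonzero constant k, so x'(λ) is nowhere a multiple of n and t is an affine parameter up to scale. If moreover k > 0, then after reparametrizing x by t its q-component q(t) is a C² solution of the Euler–Lagrange equations of the classical Lagrangian L(t,q,q̇) = ½·a(t,q)(q̇,q̇) + b(t,q)(q̇) − 𝒰(t,q), and its y-component satisfies y(t) − y(t₀) = ∫_{t₀}^{t} L(s,q(s),q'(s)) ds; i.e. every such lightlike geodesic is the light lift of its own projection, and the increment of the y-coordinate along it equals the classical action of the projection. -/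
open Set

/-- A function with vanishing derivative on a closed interval is constant there. -/
theorem eq_left_of_hasDerivWithinAt_Icc_zero {f : ℝ → ℝ} {l₀ l₁ : ℝ}
    (h : ∀ l ∈ Icc l₀ l₁, HasDerivWithinAt f 0 (Icc l₀ l₁) l) :
    ∀ l ∈ Icc l₀ l₁, f l = f l₀ :=
  constant_of_has_deriv_right_zero (fun l hl => (h l hl).continuousWithinAt)
    fun l hl => (h l (Ico_subset_Icc_self hl)).mono_of_mem_nhdsWithin (Icc_mem_nhdsGE_of_mem hl)

/-- On vectors with nonzero time component `k`, the Eisenhart quadratic form is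
`2k²` times the classical Lagrangian of the rescaled velocity, up to the term `-2kυ`. -/
theorem barG_self_eq_classicalLag {d : ℕ}
    {a : ℝ → (Fin d → ℝ) → (Fin d → ℝ) → (Fin d → ℝ) → ℝ}
    {b : ℝ → (Fin d → ℝ) → (Fin d → ℝ) → ℝ} (𝒰 : ℝ → (Fin d → ℝ) → ℝ)
    (hsymm : ∀ t q v w, a t q v w = a t q w v)
    (halin : ∀ t q w, IsLinearMap ℝ (fun v => a t q v w))
    (hblin : ∀ t q, IsLinearMap ℝ (b t q))
    (x V : ℝ × (Fin d → ℝ) × ℝ) (hV : V.1 ≠ 0) :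
    barG a b 𝒰 x V V =
      2 * V.1 ^ 2 * classicalLag a b 𝒰 x.1 x.2.1 (V.1⁻¹ • V.2.1) - 2 * V.1 * V.2.2 := by
  have ha : a x.1 x.2.1 (V.1⁻¹ • V.2.1) (V.1⁻¹ • V.2.1) =
      V.1⁻¹ * (V.1⁻¹ * a x.1 x.2.1 V.2.1 V.2.1) := by
    rw [(halin _ _ _).map_smul, hsymm, (halin _ _ _).map_smul, smul_eq_mul, smul_eq_mul]
  have hb : b x.1 x.2.1 (V.1⁻¹ • V.2.1) = V.1⁻¹ * b x.1 x.2.1 V.2.1 :=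
    (hblin _ _).map_smul _ _
  simp only [barG, classicalLag, ha, hb]
  field_simp
  ring

/-- The momentum conjugate to `y` is `-2` times the time component of the velocity. -/
theorem deriv_barG_vertical {d : ℕ}
    (a : ℝ → (Fin d → ℝ) → (Fin d → ℝ) → (Fin d → ℝ) → ℝ)
    (b : ℝ → (Fin d → ℝ) → (Fin d → ℝ) → ℝ) (𝒰 : ℝ → (Fin d → ℝ) → ℝ)
    (x V : ℝ × (Fin d → ℝ) × ℝ) :
    deriv (fun h : ℝ => barG a b 𝒰 x (V + h • ((0, 0, 1) : ℝ × (Fin d → ℝ) × ℝ))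
      (V + h • ((0, 0, 1) : ℝ × (Fin d → ℝ) × ℝ))) 0 = -2 * V.1 := by
  have h : (fun h : ℝ => barG a b 𝒰 x (V + h • ((0, 0, 1) : ℝ × (Fin d → ℝ) × ℝ))
      (V + h • ((0, 0, 1) : ℝ × (Fin d → ℝ) × ℝ))) =
      fun h => (-2 * V.1) * h + barG a b 𝒰 x V V := by
    funext h
    simp [barG]
    ring
  rw [h, deriv_add_const, deriv_const_mul_field, deriv_id'', mul_one]

/-- The momentum of the energy Lagrangian in a spatial direction is `2k` times the
classical momentum, `k` being the time component of the velocity. -/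
theorem deriv_barG_velocity {d : ℕ}
    {a : ℝ → (Fin d → ℝ) → (Fin d → ℝ) → (Fin d → ℝ) → ℝ}
    {b : ℝ → (Fin d → ℝ) → (Fin d → ℝ) → ℝ} (𝒰 : ℝ → (Fin d → ℝ) → ℝ)
    (hsymm : ∀ t q v w, a t q v w = a t q w v)
    (halin : ∀ t q w, IsLinearMap ℝ (fun v => a t q v w))
    (hblin : ∀ t q, IsLinearMap ℝ (b t q))
    (x V : ℝ × (Fin d → ℝ) × ℝ) (hV : V.1 ≠ 0) (e : Fin d → ℝ) :
    deriv (fun h : ℝ => barG a b 𝒰 x (V + h • ((0, e, 0) : ℝ × (Fin d → ℝ) × ℝ))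
      (V + h • ((0, e, 0) : ℝ × (Fin d → ℝ) × ℝ))) 0 =
      2 * V.1 * deriv (fun h : ℝ =>
        classicalLag a b 𝒰 x.1 x.2.1 (V.1⁻¹ • V.2.1 + h • e)) 0 := by
  have key : (fun h : ℝ => barG a b 𝒰 x (V + h • ((0, e, 0) : ℝ × (Fin d → ℝ) × ℝ))
      (V + h • ((0, e, 0) : ℝ × (Fin d → ℝ) × ℝ))) =
      fun h => 2 * V.1 ^ 2 * classicalLag a b 𝒰 x.1 x.2.1
        (V.1⁻¹ • V.2.1 + (V.1⁻¹ * h) • e) - 2 * V.1 * V.2.2 := by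
    funext h
    rw [barG_self_eq_classicalLag 𝒰 hsymm halin hblin _ _ (by simpa using hV)]
    simp [smul_add, smul_smul]
  rw [key, deriv_sub_const, deriv_const_mul_field,
    deriv_comp_mul_left V.1⁻¹
      (fun h => classicalLag a b 𝒰 x.1 x.2.1 (V.1⁻¹ • V.2.1 + h • e)) 0,
    mul_zero, smul_eq_mul]
  field_simp

/-- The force of the energy Lagrangian in a spatial direction is `2k²` times the
classical force, `k` being the time component of the velocity. -/
theorem deriv_barG_position {d : ℕ}
    {a : ℝ → (Fin d → ℝ) → (Fin d → ℝ) → (Fin d → ℝ) → ℝ}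
    {b : ℝ → (Fin d → ℝ) → (Fin d → ℝ) → ℝ} (𝒰 : ℝ → (Fin d → ℝ) → ℝ)
    (hsymm : ∀ t q v w, a t q v w = a t q w v)
    (halin : ∀ t q w, IsLinearMap ℝ (fun v => a t q v w))
    (hblin : ∀ t q, IsLinearMap ℝ (b t q))
    (x V : ℝ × (Fin d → ℝ) × ℝ) (hV : V.1 ≠ 0) (e : Fin d → ℝ) :
    deriv (fun h : ℝ => barG a b 𝒰 (x + h • ((0, e, 0) : ℝ × (Fin d → ℝ) × ℝ)) V V) 0 =
      2 * V.1 ^ 2 * deriv (fun h : ℝ =>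
        classicalLag a b 𝒰 x.1 (x.2.1 + h • e) (V.1⁻¹ • V.2.1)) 0 := by
  have key : (fun h : ℝ => barG a b 𝒰 (x + h • ((0, e, 0) : ℝ × (Fin d → ℝ) × ℝ)) V V) =
      fun h => 2 * V.1 ^ 2 * classicalLag a b 𝒰 x.1 (x.2.1 + h • e)
        (V.1⁻¹ • V.2.1) - 2 * V.1 * V.2.2 := by
    funext h
    rw [barG_self_eq_classicalLag 𝒰 hsymm halin hblin _ _ hV]
    simp
  rw [key, deriv_sub_const, deriv_const_mul_field]

/-- A lightlike geodesic of the Eisenhart metric not tangent to `n` has `t' = k ≠ 0`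
constant; if `k > 0` then, reparametrized by `t`, its `q`-component solves the
classical Euler–Lagrange equations and the increment of its `y`-component equals the
classical action of the projection: every such lightlike geodesic is the light lift
of its own projection. -/
theorem lightlike_geodesic_is_light_lift (d : ℕ) (hd : 1 ≤ d)
    (a : ℝ → (Fin d → ℝ) → (Fin d → ℝ) → (Fin d → ℝ) → ℝ)
    (b : ℝ → (Fin d → ℝ) → (Fin d → ℝ) → ℝ)
    (𝒰 : ℝ → (Fin d → ℝ) → ℝ)
    (hsymm : ∀ t q v w, a t q v w = a t q w v)
    (halin : ∀ t q w, IsLinearMap ℝ (fun v => a t q v w))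
    (hapos : ∀ t q v, v ≠ 0 → 0 < a t q v v)
    (hblin : ∀ t q, IsLinearMap ℝ (b t q))
    (hareg : ∀ v w, ContDiff ℝ 2 (fun p : ℝ × (Fin d → ℝ) => a p.1 p.2 v w))
    (hbreg : ∀ v, ContDiff ℝ 2 (fun p : ℝ × (Fin d → ℝ) => b p.1 p.2 v))
    (hUreg : ContDiff ℝ 2 (fun p : ℝ × (Fin d → ℝ) => 𝒰 p.1 p.2))
    (lam₀ lam₁ : ℝ) (hlam : lam₀ < lam₁)
    (x x' x'' : ℝ → ℝ × (Fin d → ℝ) × ℝ)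
    (hx : ∀ l ∈ Icc lam₀ lam₁, HasDerivWithinAt x (x' l) (Icc lam₀ lam₁) l)
    (hx' : ∀ l ∈ Icc lam₀ lam₁, HasDerivWithinAt x' (x'' l) (Icc lam₀ lam₁) l)
    (hx'' : ContinuousOn x'' (Icc lam₀ lam₁))
    (hEL : SatisfiesEL (fun p V => barG a b 𝒰 p V V) x x' (Icc lam₀ lam₁))
    (hnull : ∀ l ∈ Icc lam₀ lam₁, barG a b 𝒰 (x l) (x' l) (x' l) = 0)
    (hnotn : ¬ ∃ c : ℝ, x' lam₀ = c • ((0, 0, 1) : ℝ × (Fin d → ℝ) × ℝ)) :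
    ∃ k : ℝ, k ≠ 0 ∧ (∀ l ∈ Icc lam₀ lam₁, (x' l).1 = k) ∧
      (0 < k →
        ∃ (qt qt' qt'' : ℝ → Fin d → ℝ) (yt : ℝ → ℝ),
          (∀ l ∈ Icc lam₀ lam₁,
              (x l).2.1 = qt ((x l).1) ∧ (x l).2.2 = yt ((x l).1)) ∧
          (∀ t ∈ Icc (x lam₀).1 (x lam₁).1,
              HasDerivWithinAt qt (qt' t) (Icc (x lam₀).1 (x lam₁).1) t) ∧
          (∀ t ∈ Icc (x lam₀).1 (x lam₁).1,
              HasDerivWithinAt qt' (qt'' t) (Icc (x lam₀).1 (x lam₁).1) t) ∧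
          ContinuousOn qt'' (Icc (x lam₀).1 (x lam₁).1) ∧
          SatisfiesELClassical (classicalLag a b 𝒰) qt qt'
            (Icc (x lam₀).1 (x lam₁).1) ∧
          (∀ t ∈ Icc (x lam₀).1 (x lam₁).1,
              yt t - yt ((x lam₀).1)
                = ∫ s in (x lam₀).1..t, classicalLag a b 𝒰 s (qt s) (qt' s))) := by
  set I := Icc lam₀ lam₁ with hI
  have hmem₀ : lam₀ ∈ I := left_mem_Icc.2 hlam.le
  have hmem₁ : lam₁ ∈ I := right_mem_Icc.2 hlam.le
  have htime : ∀ l ∈ I, (x' l).1 = (x' lam₀).1 := by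
    have h := eq_left_of_hasDerivWithinAt_Icc_zero (l₀ := lam₀) (l₁ := lam₁)
      (f := fun l => -2 * (x' l).1) fun l hl => by
        have := hEL (0, 0, 1) l hl
        simp only [deriv_barG_vertical] at this
        simpa [barG] using this
    intro l hl
    linarith [h l hl]
  obtain ⟨k, hk⟩ : ∃ k, k = (x' lam₀).1 := ⟨_, rfl⟩
  rw [← hk] at htime
  have hk0 : k ≠ 0 := by
    intro h0
    have hn := hnull lam₀ hmem₀
    simp only [barG, ← hk, h0, zero_mul, mul_zero, sub_zero] at hn
    have hv : (x' lam₀).2.1 = 0 := by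
      by_contra hv
      exact (hapos _ _ _ hv).ne' hn
    exact hnotn ⟨(x' lam₀).2.2, by ext <;> simp [hv, ← hk, h0]⟩
  refine ⟨k, hk0, htime, fun hkpos => ?_⟩
  have htaff : ∀ l ∈ I, (x l).1 = (x lam₀).1 + k * (l - lam₀) := by
    have h := eq_left_of_hasDerivWithinAt_Icc_zero (l₀ := lam₀) (l₁ := lam₁)
      (f := fun l => (x l).1 - k * l) fun l hl => by
        have h1 : HasDerivWithinAt (fun l => (x l).1) (x' l).1 I l := (hx l hl).fst
        refine (h1.sub ((hasDerivWithinAt_id l _).const_mul k)).congr_deriv ?_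
        rw [htime l hl, mul_one, sub_self]
    intro l hl
    linarith [h l hl]
  obtain ⟨φ, hφ⟩ : ∃ φ : ℝ → ℝ, φ = fun t => lam₀ + k⁻¹ * (t - (x lam₀).1) := ⟨_, rfl⟩
  have hφx : ∀ l ∈ I, φ (x l).1 = l := by
    intro l hl
    rw [hφ, htaff l hl]
    field_simp
    ring
  set J := Icc (x lam₀).1 (x lam₁).1 with hJ
  have hφJ : MapsTo φ J I := by
    intro t ht
    have h1 := ht.2
    rw [htaff lam₁ hmem₁] at h1
    have h2 : t - (x lam₀).1 = k * (φ t - lam₀) := by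
      rw [hφ]
      field_simp
      ring
    have h3 : 0 ≤ k * (φ t - lam₀) := by linarith [ht.1]
    have h4 : k * (φ t - lam₀) ≤ k * (lam₁ - lam₀) := by linarith
    exact ⟨by linarith [nonneg_of_mul_nonneg_right h3 hkpos],
      by linarith [le_of_mul_le_mul_left h4 hkpos]⟩
  have hxφ : ∀ t ∈ J, (x (φ t)).1 = t := by
    intro t ht
    rw [htaff _ (hφJ ht), hφ]
    field_simp
    ring
  have hφd : ∀ t, HasDerivWithinAt φ k⁻¹ J t := by
    intro t
    rw [hφ]
    simpa using (((hasDerivWithinAt_id t J).sub_const (x lam₀).1).const_mul k⁻¹).const_add lam₀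
  have hφc : ContinuousOn φ J := fun t _ => (hφd t).continuousWithinAt
  have hx'c : ContinuousOn x' I := fun l hl => (hx' l hl).continuousWithinAt
  have hqd : ∀ t ∈ J, HasDerivWithinAt (fun t => (x (φ t)).2.1) (k⁻¹ • (x' (φ t)).2.1) J t :=
    fun t ht => ((hx _ (hφJ ht)).scomp t (hφd t) hφJ).snd.fst
  have hyd : ∀ t ∈ J, HasDerivWithinAt (fun t => (x (φ t)).2.2) (k⁻¹ * (x' (φ t)).2.2) J t :=
    fun t ht => ((hx _ (hφJ ht)).scomp t (hφd t) hφJ).snd.snd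
  have hvd : ∀ t ∈ J, HasDerivWithinAt (fun t => (x' (φ t)).2.1) (k⁻¹ • (x'' (φ t)).2.1) J t :=
    fun t ht => ((hx' _ (hφJ ht)).scomp t (hφd t) hφJ).snd.fst
  refine ⟨fun t => (x (φ t)).2.1, fun t => k⁻¹ • (x' (φ t)).2.1,
    fun t => k⁻¹ • k⁻¹ • (x'' (φ t)).2.1, fun t => (x (φ t)).2.2,
    fun l hl => by simp only [hφx l hl, and_self], hqd,
    fun t ht => (hvd t ht).const_smul k⁻¹,
    ((hx''.comp hφc hφJ).snd.fst.const_smul k⁻¹).const_smul k⁻¹, ?_, ?_⟩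
  · intro e t ht
    have h := (hEL (0, e, 0) _ (hφJ ht)).scomp t (hφd t) hφJ
    have hne : ∀ s ∈ J, (x' (φ s)).1 ≠ 0 := fun s hs => by rwa [htime _ (hφJ hs)]
    rw [deriv_barG_position 𝒰 hsymm halin hblin _ _ (hne t ht), hxφ t ht,
      htime _ (hφJ ht)] at h
    have hmom : ∀ s ∈ J, deriv (fun h : ℝ => classicalLag a b 𝒰 s (x (φ s)).2.1
          (k⁻¹ • (x' (φ s)).2.1 + h • e)) 0 =
        (2 * k)⁻¹ * deriv (fun h : ℝ => barG a b 𝒰 (x (φ s))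
          (x' (φ s) + h • ((0, e, 0) : ℝ × (Fin d → ℝ) × ℝ))
          (x' (φ s) + h • ((0, e, 0) : ℝ × (Fin d → ℝ) × ℝ))) 0 := by
      intro s hs
      rw [deriv_barG_velocity 𝒰 hsymm halin hblin _ _ (hne s hs), hxφ s hs, htime _ (hφJ hs)]
      field_simp
    refine ((h.const_mul (2 * k)⁻¹).congr_of_mem hmom ht).congr_deriv ?_
    rw [smul_eq_mul]
    field_simp
  · have hlag : ∀ t ∈ J, k⁻¹ * (x' (φ t)).2.2 =
        classicalLag a b 𝒰 t (x (φ t)).2.1 (k⁻¹ • (x' (φ t)).2.1) := by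
      intro t ht
      have h := hnull _ (hφJ ht)
      rw [barG_self_eq_classicalLag 𝒰 hsymm halin hblin _ _ (by rwa [htime _ (hφJ ht)]),
        htime _ (hφJ ht), hxφ t ht] at h
      rw [inv_mul_eq_iff_eq_mul₀ hk0]
      refine mul_left_cancel₀ (mul_ne_zero two_ne_zero hk0) ?_
      linear_combination -h
    intro t ht
    have hsub : Icc (x lam₀).1 t ⊆ J := Icc_subset_Icc_right ht.2
    have hcont : ContinuousOn (fun t => k⁻¹ * (x' (φ t)).2.2) (Icc (x lam₀).1 t) :=
      ((hx'c.comp hφc hφJ).snd.snd.mono hsub).const_mul k⁻¹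
    symm
    rw [← intervalIntegral.integral_eq_sub_of_hasDerivAt_of_le ht.1
      (fun s hs => ((hyd s (hsub hs)).continuousWithinAt).mono hsub)
      (fun s hs => (hyd s (hsub (Ioo_subset_Icc_self hs))).hasDerivAt
        (Icc_mem_nhds hs.1 (hs.2.trans_le ht.2)))
      (hcont.intervalIntegrable_of_Icc ht.1)]
    refine intervalIntegral.integral_congr fun s hs => ?_
    rw [uIcc_of_le ht.1] at hs
    exact (hlag s (hsub hs)).symm
end

section
/- Let e₀ = (t₀,q₀) and e₁ = (t₁,q₁) with t₀ < t₁, and let m₀ = (t₀,q₀,y₀) ∈ M. Then, as an equality in ℝ ∪ {−∞}: inf { y-component of x(λ₁) : x : [λ₀,λ₁] → M a future-directed causal C¹ curve with x(λ₀) = m₀ whose endpoint x(λ₁) has (t,q)-components equal to (t₁,q₁) } = y₀ + inf { I[q] : q ∈ C¹([t₀,t₁], ℝ^d), q(t₀) = q₀, q(t₁) = q₁ }. -/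
open Set

/-- A vector `V = (τ,v,υ)` is future-directed causal at `x` if `Q_x(V) ≤ 0` and
either `τ > 0`, or `τ = 0` and `υ > 0`. -/
def FDCausalB {d : ℕ}
    (a : ℝ → (Fin d → ℝ) → (Fin d → ℝ) → (Fin d → ℝ) → ℝ)
    (b : ℝ → (Fin d → ℝ) → (Fin d → ℝ) → ℝ)
    (𝒰 : ℝ → (Fin d → ℝ) → ℝ)
    (x V : ℝ × (Fin d → ℝ) × ℝ) : Prop :=
  barG a b 𝒰 x V V ≤ 0 ∧ (0 < V.1 ∨ (V.1 = 0 ∧ 0 < V.2.2))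

section CausalCurves

open Filter Topology MeasureTheory

lemma continuous_of_isLinearMap_family {X : Type*} [TopologicalSpace X] {d : ℕ}
    {f : X → (Fin d → ℝ) → ℝ} (hlin : ∀ x, IsLinearMap ℝ (f x))
    (hcont : ∀ v, Continuous fun x => f x v) :
    Continuous fun z : X × (Fin d → ℝ) => f z.1 z.2 := by
  have h : (fun z : X × (Fin d → ℝ) => f z.1 z.2)
      = fun z => ∑ i, z.2 i * f z.1 fun j => if i = j then 1 else 0 := by
    funext z
    exact (IsLinearMap.mk' _ (hlin z.1)).pi_apply_eq_sum_univ z.2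
  rw [h]
  exact continuous_finsetSum _ fun i _ =>
    ((continuous_apply i).comp continuous_snd).mul ((hcont _).comp continuous_fst)

lemma continuous_bilin_diag {d : ℕ}
    {a : ℝ → (Fin d → ℝ) → (Fin d → ℝ) → (Fin d → ℝ) → ℝ}
    (hsymm : ∀ t q v w, a t q v w = a t q w v)
    (halin : ∀ t q w, IsLinearMap ℝ (fun v => a t q v w))
    (hareg : ∀ v w, Continuous fun p : ℝ × (Fin d → ℝ) => a p.1 p.2 v w) :
    Continuous fun z : (ℝ × (Fin d → ℝ)) × (Fin d → ℝ) => a z.1.1 z.1.2 z.2 z.2 := by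
  have h₁ (w : Fin d → ℝ) := continuous_of_isLinearMap_family
    (f := fun p : ℝ × (Fin d → ℝ) => fun v => a p.1 p.2 v w)
    (fun p => halin p.1 p.2 w) (fun v => hareg v w)
  have h₂ := continuous_of_isLinearMap_family
    (f := fun z : (ℝ × (Fin d → ℝ)) × (Fin d → ℝ) => fun w => a z.1.1 z.1.2 z.2 w)
    (fun z => by
      have := halin z.1.1 z.1.2 z.2
      simpa only [hsymm z.1.1 z.1.2 _ z.2] using this) h₁
  exact h₂.comp (continuous_id.prodMk continuous_snd)

/-- A `C¹` curve on a compact interval extends to a `C¹` curve on the line whose velocity is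
constant on either side of the interval. -/
lemma exists_hasDerivAt_extension {E : Type*} [NormedAddCommGroup E] [NormedSpace ℝ E]
    [CompleteSpace E] {l₀ l₁ : ℝ} (hl : l₀ < l₁) {x x' : ℝ → E}
    (hx : ∀ l ∈ Icc l₀ l₁, HasDerivWithinAt x (x' l) (Icc l₀ l₁) l)
    (hx' : ContinuousOn x' (Icc l₀ l₁)) :
    ∃ X X' : ℝ → E, (∀ l, HasDerivAt X (X' l) l) ∧ Continuous X' ∧ EqOn X x (Icc l₀ l₁) ∧
      EqOn X' x' (Icc l₀ l₁) ∧ ∀ l, ∃ k ∈ Icc l₀ l₁, X' l = x' k := by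
  let X' : ℝ → E := IccExtend hl.le ((Icc l₀ l₁).domRestrict x')
  have hX' : Continuous X' := (continuousOn_iff_continuous_domRestrict.1 hx').Icc_extend'
  have hEq : EqOn X' x' (Icc l₀ l₁) := fun l h => IccExtend_of_mem hl.le _ h
  refine ⟨fun l => x l₀ + ∫ s in l₀..l, X' s, X', fun l => ?_, hX', fun l h => ?_, hEq,
    fun l => ⟨projIcc l₀ l₁ hl.le l, Subtype.coe_prop _, rfl⟩⟩
  · exact (intervalIntegral.integral_hasDerivAt_right (hX'.intervalIntegrable _ _)
      (hX'.stronglyMeasurableAtFilter _ _) hX'.continuousAt).const_add _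
  · have hsub : Icc l₀ l ⊆ Icc l₀ l₁ := Icc_subset_Icc_right h.2
    have := intervalIntegral.integral_eq_sub_of_hasDerivAt_of_le h.1
      (fun s hs => ((hx s (hsub hs)).continuousWithinAt).mono hsub)
      (f' := X') (fun s hs => by
        have hs' := hsub (Ioo_subset_Icc_self hs)
        rw [hEq hs']
        exact (hx s hs').hasDerivAt (Icc_mem_nhds hs.1 (hs.2.trans_le h.2)))
      (hX'.intervalIntegrable _ _)
    simp only [this]
    abel

/-- A `C¹` curve can be reparametrized by any change of parameter with derivative bounded below
by a positive constant. -/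
lemma exists_reparametrization {E : Type*} [NormedAddCommGroup E] [NormedSpace ℝ E]
    {θ θ' : ℝ → ℝ} {m : ℝ} (hm : 0 < m) (hθ : ∀ l, HasDerivAt θ (θ' l) l)
    (hθ' : Continuous θ') (hθm : ∀ l, m ≤ θ' l) {q q' : ℝ → E}
    (hq : ∀ l, HasDerivAt q (q' l) l) (hq' : Continuous q') :
    ∃ r r' : ℝ → E, (∀ s, HasDerivAt r (r' s) s) ∧ Continuous r' ∧ (∀ l, r (θ l) = q l) ∧
      ∀ l, r' (θ l) = (θ' l)⁻¹ • q' l := by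
  have hpos l : 0 < θ' l := hm.trans_le (hθm l)
  have hmono : StrictMono θ := strictMono_of_hasDerivAt_pos hθ hpos
  have hcont : Continuous θ := continuous_iff_continuousAt.2 fun l => (hθ l).continuousAt
  have hgrow : Monotone fun l => θ l - m * l :=
    monotone_of_hasDerivAt_nonneg (f' := fun l => θ' l - m)
      (fun l => by simpa using! (hθ l).sub ((hasDerivAt_id l).const_mul m))
      fun l => by simpa using hθm l
  have htop : Tendsto θ atTop atTop := by
    refine tendsto_atTop_mono' _ (f₁ := fun l => m * l + θ 0) ?_
      (tendsto_atTop_add_const_right _ _ (tendsto_id.const_mul_atTop hm))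
    filter_upwards [eventually_ge_atTop 0] with l h
    have := hgrow h
    simp only at this
    linarith
  have hbot : Tendsto θ atBot atBot := by
    refine tendsto_atBot_mono' _ (f₁ := fun l => m * l + θ 0) ?_
      (tendsto_atBot_add_const_right _ _ (tendsto_id.const_mul_atBot hm))
    filter_upwards [eventually_le_atBot 0] with l h
    have := hgrow h
    simp only at this
    linarith
  let e : ℝ ≃o ℝ := hmono.orderIsoOfSurjective θ (hcont.surjective htop hbot)
  have he l : e.symm (θ l) = l := e.symm_apply_apply l
  have he' s : θ (e.symm s) = s := e.apply_symm_apply s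
  have hderiv s : HasDerivAt e.symm (θ' (e.symm s))⁻¹ s :=
    HasDerivAt.of_local_left_inverse e.symm.continuous.continuousAt (hθ _) (hpos _).ne'
      (Eventually.of_forall he')
  refine ⟨fun s => q (e.symm s), fun s => (θ' (e.symm s))⁻¹ • q' (e.symm s), fun s => ?_, ?_,
    fun l => by simp only [he], fun l => by simp only [he]⟩
  · exact HasDerivAt.scomp s (hq _) (hderiv s)
  · exact ((hθ'.comp e.symm.continuous).inv₀ fun s => (hpos _).ne').smul
      (hq'.comp e.symm.continuous)

lemma classicalLag_inv_smul_mul {d : ℕ}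
    {a : ℝ → (Fin d → ℝ) → (Fin d → ℝ) → (Fin d → ℝ) → ℝ}
    {b : ℝ → (Fin d → ℝ) → (Fin d → ℝ) → ℝ}
    (𝒰 : ℝ → (Fin d → ℝ) → ℝ)
    (hsymm : ∀ t q v w, a t q v w = a t q w v)
    (halin : ∀ t q w, IsLinearMap ℝ (fun v => a t q v w))
    (hblin : ∀ t q, IsLinearMap ℝ (b t q))
    (t : ℝ) (p v : Fin d → ℝ) {r : ℝ} (hr : r ≠ 0) :
    classicalLag a b 𝒰 t p (r⁻¹ • v) * r = a t p v v / (2 * r) + b t p v - 𝒰 t p * r := by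
  have h₁ : a t p (r⁻¹ • v) (r⁻¹ • v) = r⁻¹ * (r⁻¹ * a t p v v) := by
    rw [(halin t p _).map_smul, hsymm, (halin t p _).map_smul]; rfl
  rw [classicalLag, h₁, (hblin t p).map_smul, smul_eq_mul]
  field_simp

/-- On a compact family of base points, the value of a positive definite form at a displaced time
is controlled by its value at the original time. -/
lemma exists_bilin_diag_le_mul {d : ℕ}
    {a : ℝ → (Fin d → ℝ) → (Fin d → ℝ) → (Fin d → ℝ) → ℝ}
    (hsymm : ∀ t q v w, a t q v w = a t q w v)
    (halin : ∀ t q w, IsLinearMap ℝ (fun v => a t q v w))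
    (hapos : ∀ t q v, v ≠ 0 → 0 < a t q v v)
    (ha : Continuous fun z : (ℝ × (Fin d → ℝ)) × (Fin d → ℝ) => a z.1.1 z.1.2 z.2 z.2)
    {J L : Set ℝ} (hJ : IsCompact J) (hL : IsCompact L) {t : ℝ → ℝ} {q : ℝ → Fin d → ℝ}
    (ht : Continuous t) (hq : Continuous q) :
    ∃ K, 0 ≤ K ∧ ∀ s ∈ J, ∀ l ∈ L, ∀ v, a s (q l) v v ≤ K * a (t l) (q l) v v := by
  have hS : IsCompact ((J ×ˢ L) ×ˢ Metric.sphere (0 : Fin d → ℝ) 1) :=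
    (hJ.prod hL).prod (isCompact_sphere _ _)
  have hcont : ContinuousOn (fun z : (ℝ × ℝ) × (Fin d → ℝ) =>
      a z.1.1 (q z.1.2) z.2 z.2 / a (t z.1.2) (q z.1.2) z.2 z.2)
      ((J ×ˢ L) ×ˢ Metric.sphere (0 : Fin d → ℝ) 1) := by
    refine ContinuousOn.div (Continuous.continuousOn ?_) (Continuous.continuousOn ?_) ?_
    · exact ha.comp (g := fun z => _) (f := fun z : (ℝ × ℝ) × (Fin d → ℝ) =>
        ((z.1.1, q z.1.2), z.2)) (by fun_prop)
    · exact ha.comp (g := fun z => _) (f := fun z : (ℝ × ℝ) × (Fin d → ℝ) =>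
        ((t z.1.2, q z.1.2), z.2)) (by fun_prop)
    · rintro z ⟨-, hz⟩
      exact (hapos _ _ _ (Metric.ne_of_mem_sphere hz one_ne_zero)).ne'
  obtain ⟨K, hK⟩ := hS.bddAbove_image hcont
  refine ⟨max K 0, le_max_right _ _, fun s hs l hl v => ?_⟩
  rcases eq_or_ne v 0 with rfl | hv
  · simp [(halin _ _ _).map_zero]
  · have hn : ‖v‖ ≠ 0 := norm_ne_zero_iff.2 hv
    have hu : ‖v‖⁻¹ • v ∈ Metric.sphere (0 : Fin d → ℝ) 1 := by
      simp [norm_smul, hn]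
    have hscale (s : ℝ) (p : Fin d → ℝ) :
        a s p (‖v‖⁻¹ • v) (‖v‖⁻¹ • v) = ‖v‖⁻¹ * ‖v‖⁻¹ * a s p v v := by
      rw [(halin s p _).map_smul, hsymm, (halin s p _).map_smul, smul_eq_mul, smul_eq_mul,
        mul_assoc]
    have h := hK (mem_image_of_mem _ (mk_mem_prod (mk_mem_prod hs hl) hu))
    simp only [hscale] at h
    rw [mul_div_mul_left _ _ (by positivity), div_le_iff₀ (hapos _ _ _ hv)] at h
    exact h.trans (mul_le_mul_of_nonneg_right (le_max_left _ _) (hapos _ _ _ hv).le)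

lemma FDCausalB.fst_nonneg {d : ℕ}
    {a : ℝ → (Fin d → ℝ) → (Fin d → ℝ) → (Fin d → ℝ) → ℝ}
    {b : ℝ → (Fin d → ℝ) → (Fin d → ℝ) → ℝ} {𝒰 : ℝ → (Fin d → ℝ) → ℝ}
    {x V : ℝ × (Fin d → ℝ) × ℝ} (h : FDCausalB a b 𝒰 x V) : 0 ≤ V.1 :=
  h.2.elim le_of_lt fun h => h.1.ge

lemma FDCausalB.bilin_diag_le {d : ℕ}
    {a : ℝ → (Fin d → ℝ) → (Fin d → ℝ) → (Fin d → ℝ) → ℝ}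
    {b : ℝ → (Fin d → ℝ) → (Fin d → ℝ) → ℝ} {𝒰 : ℝ → (Fin d → ℝ) → ℝ}
    {x V : ℝ × (Fin d → ℝ) × ℝ} (h : FDCausalB a b 𝒰 x V) :
    a x.1 x.2.1 V.2.1 V.2.1
      ≤ 2 * V.1 * (V.2.2 - b x.1 x.2.1 V.2.1 + 𝒰 x.1 x.2.1 * V.1) := by
  have := h.1
  unfold barG at this
  linarith

lemma FDCausalB.velocity_eq_zero {d : ℕ}
    {a : ℝ → (Fin d → ℝ) → (Fin d → ℝ) → (Fin d → ℝ) → ℝ}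
    {b : ℝ → (Fin d → ℝ) → (Fin d → ℝ) → ℝ} {𝒰 : ℝ → (Fin d → ℝ) → ℝ}
    {x V : ℝ × (Fin d → ℝ) × ℝ} (hapos : ∀ t q v, v ≠ 0 → 0 < a t q v v)
    (h : FDCausalB a b 𝒰 x V) (hV : V.1 = 0) : V.2.1 = 0 := by
  by_contra hne
  have := h.bilin_diag_le
  rw [hV] at this
  linarith [hapos x.1 x.2.1 _ hne]

/-- The slack in the causality condition is nonnegative, and dominates the kinetic term. -/
lemma FDCausalB.kinetic_le {d : ℕ}
    {a : ℝ → (Fin d → ℝ) → (Fin d → ℝ) → (Fin d → ℝ) → ℝ}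
    {b : ℝ → (Fin d → ℝ) → (Fin d → ℝ) → ℝ} {𝒰 : ℝ → (Fin d → ℝ) → ℝ}
    {x V : ℝ × (Fin d → ℝ) × ℝ} (halin : ∀ t q w, IsLinearMap ℝ (fun v => a t q v w))
    (hapos : ∀ t q v, v ≠ 0 → 0 < a t q v v)
    (hblin : ∀ t q, IsLinearMap ℝ (b t q)) (h : FDCausalB a b 𝒰 x V) {ε : ℝ} (hε : 0 ≤ ε) :
    0 ≤ a x.1 x.2.1 V.2.1 V.2.1 / (2 * (V.1 + ε)) ∧ a x.1 x.2.1 V.2.1 V.2.1 / (2 * (V.1 + ε))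
      ≤ V.2.2 - b x.1 x.2.1 V.2.1 + 𝒰 x.1 x.2.1 * V.1 := by
  have ha0 : 0 ≤ a x.1 x.2.1 V.2.1 V.2.1 := by
    rcases eq_or_ne V.2.1 0 with h0 | h0
    · rw [h0, (halin _ _ _).map_zero]
    · exact (hapos _ _ _ h0).le
  have hle := h.bilin_diag_le
  refine ⟨div_nonneg ha0 (by linarith [h.fst_nonneg]), ?_⟩
  rcases h.2 with hpos | ⟨h0, hy⟩
  · have hP : 0 ≤ V.2.2 - b x.1 x.2.1 V.2.1 + 𝒰 x.1 x.2.1 * V.1 := by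
      by_contra! hneg
      nlinarith
    rw [div_le_iff₀ (by positivity)]
    nlinarith
  · rw [h.velocity_eq_zero hapos h0, (halin _ _ _).map_zero, (hblin _ _).map_zero, h0]
    simpa using hy.le

lemma continuous_classicalLag {d : ℕ}
    {a : ℝ → (Fin d → ℝ) → (Fin d → ℝ) → (Fin d → ℝ) → ℝ}
    {b : ℝ → (Fin d → ℝ) → (Fin d → ℝ) → ℝ} {𝒰 : ℝ → (Fin d → ℝ) → ℝ}
    (ha : Continuous fun z : (ℝ × (Fin d → ℝ)) × (Fin d → ℝ) => a z.1.1 z.1.2 z.2 z.2)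
    (hb : Continuous fun z : (ℝ × (Fin d → ℝ)) × (Fin d → ℝ) => b z.1.1 z.1.2 z.2)
    (hU : Continuous fun p : ℝ × (Fin d → ℝ) => 𝒰 p.1 p.2)
    {X : Type*} [TopologicalSpace X] {t : X → ℝ} {q v : X → Fin d → ℝ}
    (ht : Continuous t) (hq : Continuous q) (hv : Continuous v) :
    Continuous fun s => classicalLag a b 𝒰 (t s) (q s) (v s) :=
  ((continuous_const.mul (ha.comp ((ht.prodMk hq).prodMk hv))).add
    (hb.comp ((ht.prodMk hq).prodMk hv))).sub (hU.comp (ht.prodMk hq))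

/-- The null lift of a `C¹` path: it is a future-directed causal curve whose arrival coordinate
is the action of the path. -/
lemma exists_causal_lift {d : ℕ}
    {a : ℝ → (Fin d → ℝ) → (Fin d → ℝ) → (Fin d → ℝ) → ℝ}
    {b : ℝ → (Fin d → ℝ) → (Fin d → ℝ) → ℝ} {𝒰 : ℝ → (Fin d → ℝ) → ℝ}
    (ha : Continuous fun z : (ℝ × (Fin d → ℝ)) × (Fin d → ℝ) => a z.1.1 z.1.2 z.2 z.2)
    (hb : Continuous fun z : (ℝ × (Fin d → ℝ)) × (Fin d → ℝ) => b z.1.1 z.1.2 z.2)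
    (hU : Continuous fun p : ℝ × (Fin d → ℝ) => 𝒰 p.1 p.2)
    {t₀ t₁ : ℝ} (ht : t₀ < t₁) (y₀ : ℝ) {q q' : ℝ → Fin d → ℝ}
    (hq : ∀ t ∈ Icc t₀ t₁, HasDerivWithinAt q (q' t) (Icc t₀ t₁) t)
    (hq' : ContinuousOn q' (Icc t₀ t₁)) :
    ∃ x x' : ℝ → ℝ × (Fin d → ℝ) × ℝ,
      (∀ l, HasDerivAt x (x' l) l) ∧ Continuous x' ∧ (∀ l, FDCausalB a b 𝒰 (x l) (x' l)) ∧
      x t₀ = (t₀, q t₀, y₀) ∧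
      x t₁ = (t₁, q t₁, y₀ + ∫ s in t₀..t₁, classicalLag a b 𝒰 s (q s) (q' s)) := by
  obtain ⟨Q, Q', hQ, hQ', hQq, hQq', -⟩ := exists_hasDerivAt_extension ht hq hq'
  have hQc : Continuous Q := continuous_iff_continuousAt.2 fun l => (hQ l).continuousAt
  have hL := continuous_classicalLag ha hb hU continuous_id hQc hQ'
  refine ⟨fun t => (t, Q t, y₀ + ∫ s in t₀..t, classicalLag a b 𝒰 s (Q s) (Q' s)),
    fun t => (1, Q' t, classicalLag a b 𝒰 t (Q t) (Q' t)), fun t => ?_,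
    continuous_const.prodMk (hQ'.prodMk hL), fun t => ⟨?_, Or.inl one_pos⟩, ?_, ?_⟩
  · exact (hasDerivAt_id t).prodMk ((hQ t).prodMk
      ((intervalIntegral.integral_hasDerivAt_right (hL.intervalIntegrable _ _)
        (hL.stronglyMeasurableAtFilter _ _) hL.continuousAt).const_add _))
  · simp only [barG, classicalLag]
    linarith
  · simp [hQq (left_mem_Icc.2 ht.le)]
  · simp only [hQq (right_mem_Icc.2 ht.le)]
    congr 3
    refine intervalIntegral.integral_congr fun s hs => ?_
    rw [uIcc_of_le ht.le] at hs
    simp only [hQq hs, hQq' hs]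

/-- Every causal curve from `(t₀, q₀, y₀)` to the fiber over `(t₁, q₁)` can be traversed with a
slightly increased time velocity, giving a `C¹` path from `q₀` to `q₁` whose action exceeds the
gain in the `y`-coordinate by an arbitrarily small amount. -/
lemma exists_action_lt_of_causal {d : ℕ}
    {a : ℝ → (Fin d → ℝ) → (Fin d → ℝ) → (Fin d → ℝ) → ℝ}
    {b : ℝ → (Fin d → ℝ) → (Fin d → ℝ) → ℝ} {𝒰 : ℝ → (Fin d → ℝ) → ℝ}
    (hsymm : ∀ t q v w, a t q v w = a t q w v)
    (halin : ∀ t q w, IsLinearMap ℝ (fun v => a t q v w))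
    (hapos : ∀ t q v, v ≠ 0 → 0 < a t q v v)
    (hblin : ∀ t q, IsLinearMap ℝ (b t q))
    (ha : Continuous fun z : (ℝ × (Fin d → ℝ)) × (Fin d → ℝ) => a z.1.1 z.1.2 z.2 z.2)
    (hb : Continuous fun z : (ℝ × (Fin d → ℝ)) × (Fin d → ℝ) => b z.1.1 z.1.2 z.2)
    (hU : Continuous fun p : ℝ × (Fin d → ℝ) => 𝒰 p.1 p.2)
    {l₀ l₁ : ℝ} (hl : l₀ < l₁) {x x' : ℝ → ℝ × (Fin d → ℝ) × ℝ}
    (hx : ∀ l ∈ Icc l₀ l₁, HasDerivWithinAt x (x' l) (Icc l₀ l₁) l)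
    (hx' : ContinuousOn x' (Icc l₀ l₁))
    (hcausal : ∀ l ∈ Icc l₀ l₁, FDCausalB a b 𝒰 (x l) (x' l))
    (ht : (x l₀).1 < (x l₁).1) {I : ℝ} (hI : (x l₁).2.2 - (x l₀).2.2 < I) :
    ∃ r r' : ℝ → Fin d → ℝ, (∀ s, HasDerivAt r (r' s) s) ∧ Continuous r' ∧
      r (x l₀).1 = (x l₀).2.1 ∧ r (x l₁).1 = (x l₁).2.1 ∧
      ∫ s in (x l₀).1..(x l₁).1, classicalLag a b 𝒰 s (r s) (r' s) < I := by
  obtain ⟨X, X', hX, hX', hXx, hXx', hXmem⟩ := exists_hasDerivAt_extension hl hx hx'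
  have hX0 := hXx (left_mem_Icc.2 hl.le)
  have hX1 := hXx (right_mem_Icc.2 hl.le)
  have hc (l : ℝ) (h : l ∈ Icc l₀ l₁) : FDCausalB a b 𝒰 (X l) (X' l) := by
    rw [hXx h, hXx' h]
    exact hcausal l h
  have hτ (l : ℝ) : 0 ≤ (X' l).1 := by
    obtain ⟨k, hk, h⟩ := hXmem l
    rw [h]
    exact (hcausal k hk).fst_nonneg
  rw [← hX0, ← hX1] at ht hI ⊢
  clear hXx hXx' hXmem hX0 hX1 hcausal hx hx' x x'
  have hXc : Continuous X := continuous_iff_continuousAt.2 fun l => (hX l).continuousAt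
  have hXt (l : ℝ) : HasDerivAt (fun l => (X l).1) (X' l).1 l := by
    simpa using (hX l).hasFDerivAt.fst.hasDerivAt
  have hXqy (l : ℝ) : HasDerivAt (fun l => (X l).2) (X' l).2 l := by
    simpa using (hX l).hasFDerivAt.snd.hasDerivAt
  have hXq (l : ℝ) : HasDerivAt (fun l => (X l).2.1) (X' l).2.1 l := by
    simpa using (hXqy l).hasFDerivAt.fst.hasDerivAt
  have hXy (l : ℝ) : HasDerivAt (fun l => (X l).2.2) (X' l).2.2 l := by
    simpa using (hXqy l).hasFDerivAt.snd.hasDerivAt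
  have hmono : Monotone fun l => (X l).1 := monotone_of_hasDerivAt_nonneg hXt hτ
  set T := (X l₁).1 - (X l₀).1 with hT
  have hT0 : 0 < T := sub_pos.2 ht
  have hΛ : 0 < l₁ - l₀ := sub_pos.2 hl
  let c : ℝ → ℝ := fun ε => T / (T + ε * (l₁ - l₀))
  let θ : ℝ → ℝ → ℝ := fun ε l => (X l₀).1 + c ε * ((X l).1 - (X l₀).1 + ε * (l - l₀))
  let θ' : ℝ → ℝ → ℝ := fun ε l => c ε * ((X' l).1 + ε)
  let G : ℝ → ℝ → ℝ := fun ε l =>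
    classicalLag a b 𝒰 (θ ε l) (X l).2.1 ((θ' ε l)⁻¹ • (X' l).2.1) * θ' ε l
  have hden {ε : ℝ} (hε : 0 < ε) : 0 < T + ε * (l₁ - l₀) := by positivity
  have hcpos {ε : ℝ} (hε : 0 < ε) : 0 < c ε := div_pos hT0 (hden hε)
  have hθ'le {ε : ℝ} (hε : 0 < ε) (l : ℝ) : c ε * ε ≤ θ' ε l :=
    mul_le_mul_of_nonneg_left (by linarith [hτ l]) (hcpos hε).le
  have hθ'pos {ε : ℝ} (hε : 0 < ε) (l : ℝ) : 0 < θ' ε l :=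
    (mul_pos (hcpos hε) hε).trans_le (hθ'le hε l)
  have hθd (ε l : ℝ) : HasDerivAt (θ ε) (θ' ε l) l := by
    have := ((((hXt l).sub_const (X l₀).1).add
      (((hasDerivAt_id l).sub_const l₀).const_mul ε)).const_mul (c ε)).const_add (X l₀).1
    simpa [θ, θ'] using! this
  have hθ'c (ε : ℝ) : Continuous (θ' ε) := by fun_prop
  have hθ0 (ε : ℝ) : θ ε l₀ = (X l₀).1 := by simp [θ]
  have hθ1 {ε : ℝ} (hε : 0 < ε) : θ ε l₁ = (X l₁).1 := by
    have := (hden hε).ne'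
    simp only [θ, c, ← hT]
    rw [div_mul_cancel₀ _ this]
    linarith
  have hθmono {ε : ℝ} (hε : 0 < ε) : Monotone (θ ε) :=
    monotone_of_hasDerivAt_nonneg (hθd ε) fun l => (hθ'pos hε l).le
  have hθmem {ε : ℝ} (hε : 0 < ε) {l : ℝ} (h : l ∈ Icc l₀ l₁) :
      θ ε l ∈ Icc (X l₀).1 (X l₁).1 :=
    ⟨(hθ0 ε).ge.trans (hθmono hε h.1), (hθmono hε h.2).trans (hθ1 hε).le⟩
  have hG {ε : ℝ} (hε : 0 < ε) (l : ℝ) : G ε l =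
      a (θ ε l) (X l).2.1 (X' l).2.1 (X' l).2.1 / (2 * θ' ε l)
        + b (θ ε l) (X l).2.1 (X' l).2.1 - 𝒰 (θ ε l) (X l).2.1 * θ' ε l :=
    classicalLag_inv_smul_mul 𝒰 hsymm halin hblin _ _ _ (hθ'pos hε l).ne'
  have hGc {ε : ℝ} (hε : 0 < ε) : Continuous (G ε) :=
    (continuous_classicalLag ha hb hU
      (continuous_iff_continuousAt.2 fun l => (hθd ε l).continuousAt) (by fun_prop)
      (((hθ'c ε).inv₀ fun l => (hθ'pos hε l).ne').smul (by fun_prop))).mul (hθ'c ε)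
  have hυc : Continuous fun l => (X' l).2.2 := by fun_prop
  have hc0 : Tendsto c (𝓝[>] 0) (𝓝 1) := by
    have : ContinuousAt c 0 := by
      refine continuousAt_const.div (by fun_prop) ?_
      simpa using hT0.ne'
    simpa [c, hT0.ne'] using this.tendsto.mono_left (nhdsWithin_le_nhds (s := Ioi 0))
  have hid : Tendsto (fun ε : ℝ => ε) (𝓝[>] 0) (𝓝 0) := nhdsWithin_le_nhds
  have hθlim (l : ℝ) : Tendsto (fun ε => θ ε l) (𝓝[>] 0) (𝓝 (X l).1) := by
    have := (hc0.mul ((hid.mul_const (l - l₀)).const_add ((X l).1 - (X l₀).1))).const_add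
      (X l₀).1
    simpa [θ] using this
  have hθ'lim (l : ℝ) : Tendsto (fun ε => θ' ε l) (𝓝[>] 0) (𝓝 (X' l).1) := by
    simpa [θ'] using hc0.mul (hid.const_add (X' l).1)
  have hGlim (l : ℝ) (h : l ∈ Icc l₀ l₁) : Tendsto (fun ε => G ε l) (𝓝[>] 0)
      (𝓝 (a (X l).1 (X l).2.1 (X' l).2.1 (X' l).2.1 / (2 * (X' l).1)
        + b (X l).1 (X l).2.1 (X' l).2.1 - 𝒰 (X l).1 (X l).2.1 * (X' l).1)) := by
    have hbl : Tendsto (fun ε => b (θ ε l) (X l).2.1 (X' l).2.1) (𝓝[>] 0)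
        (𝓝 (b (X l).1 (X l).2.1 (X' l).2.1)) :=
      (hb.tendsto (((X l).1, (X l).2.1), (X' l).2.1)).comp
        (((hθlim l).prodMk_nhds tendsto_const_nhds).prodMk_nhds tendsto_const_nhds)
    have hUl : Tendsto (fun ε => 𝒰 (θ ε l) (X l).2.1) (𝓝[>] 0)
        (𝓝 (𝒰 (X l).1 (X l).2.1)) :=
      (hU.tendsto ((X l).1, (X l).2.1)).comp ((hθlim l).prodMk_nhds tendsto_const_nhds)
    have hal : Tendsto (fun ε => a (θ ε l) (X l).2.1 (X' l).2.1 (X' l).2.1 / (2 * θ' ε l))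
        (𝓝[>] 0) (𝓝 (a (X l).1 (X l).2.1 (X' l).2.1 (X' l).2.1 / (2 * (X' l).1))) := by
      rcases (hτ l).eq_or_lt with h0 | hpos
      · simp only [(hc l h).velocity_eq_zero hapos h0.symm, (halin _ _ _).map_zero, zero_div]
        exact tendsto_const_nhds
      · exact ((ha.tendsto (((X l).1, (X l).2.1), (X' l).2.1)).comp
          (((hθlim l).prodMk_nhds tendsto_const_nhds).prodMk_nhds tendsto_const_nhds)).div
          ((hθ'lim l).const_mul 2) (by positivity)
    refine ((hal.add hbl).sub (hUl.mul (hθ'lim l))).congr' ?_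
    filter_upwards [self_mem_nhdsWithin] with ε hε
    exact (hG hε l).symm
  have hHlim (l : ℝ) (h : l ∈ Icc l₀ l₁) :
      Tendsto (fun ε => max (G ε l) (X' l).2.2) (𝓝[>] 0) (𝓝 (X' l).2.2) := by
    have hle := ((hc l h).kinetic_le halin hapos hblin le_rfl).2
    rw [add_zero] at hle
    have := (hGlim l h).max (tendsto_const_nhds (x := (X' l).2.2))
    rwa [max_eq_right (by linarith)] at this
  obtain ⟨K, hK0, hK⟩ := exists_bilin_diag_le_mul hsymm halin hapos ha
    (isCompact_Icc (a := (X l₀).1) (b := (X l₁).1)) (isCompact_Icc (a := l₀) (b := l₁))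
    (t := fun l => (X l).1) (q := fun l => (X l).2.1) (by fun_prop) (by fun_prop)
  let P : ℝ → ℝ := fun l =>
    (X' l).2.2 - b (X l).1 (X l).2.1 (X' l).2.1 + 𝒰 (X l).1 (X l).2.1 * (X' l).1
  have hPc : Continuous P :=
    (hυc.sub (hb.comp (f := fun l => (((X l).1, (X l).2.1), (X' l).2.1)) (by fun_prop))).add
      ((hU.comp (f := fun l => ((X l).1, (X l).2.1)) (by fun_prop)).mul (by fun_prop))
  have hJL := (isCompact_Icc (a := (X l₀).1) (b := (X l₁).1)).prod
    (isCompact_Icc (a := l₀) (b := l₁))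
  obtain ⟨Cp, hCp⟩ := (isCompact_Icc (a := l₀) (b := l₁)).exists_bound_of_continuousOn
    hPc.continuousOn
  obtain ⟨Cy, hCy⟩ := (isCompact_Icc (a := l₀) (b := l₁)).exists_bound_of_continuousOn
    hυc.continuousOn
  obtain ⟨Ct, hCt⟩ := (isCompact_Icc (a := l₀) (b := l₁)).exists_bound_of_continuousOn
    (f := fun l => (X' l).1) (by fun_prop)
  obtain ⟨Cb, hCb⟩ := hJL.exists_bound_of_continuousOn
    (f := fun z => b z.1 (X z.2).2.1 (X' z.2).2.1)
    (hb.comp (f := fun z : ℝ × ℝ => ((z.1, (X z.2).2.1), (X' z.2).2.1))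
      (by fun_prop)).continuousOn
  obtain ⟨Cu, hCu⟩ := hJL.exists_bound_of_continuousOn
    (f := fun z => 𝒰 z.1 (X z.2).2.1)
    (hU.comp (f := fun z : ℝ × ℝ => (z.1, (X z.2).2.1)) (by fun_prop)).continuousOn
  simp only [Real.norm_eq_abs, abs_le, mem_prod, Prod.forall] at hCp hCy hCt hCb hCu
  have hbound {ε : ℝ} (hε : 0 < ε) (hε1 : ε ≤ 1) (l : ℝ) (h : l ∈ Icc l₀ l₁) :
      |max (G ε l) (X' l).2.2|
        ≤ K * Cp * ((T + (l₁ - l₀)) / T) + Cb + Cu * (Ct + 1) + Cy := by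
    have hp := hCp l h
    have hy := hCy l h
    have htau := hCt l h
    have hbb := hCb _ l ⟨hθmem hε h, h⟩
    have huu := hCu _ l ⟨hθmem hε h, h⟩
    obtain ⟨hk0, hk⟩ := (hc l h).kinetic_le halin hapos hblin hε.le
    have hcinv : (c ε)⁻¹ ≤ (T + (l₁ - l₀)) / T := by
      simp only [c, inv_div]
      gcongr
      nlinarith
    have hc1 : c ε ≤ 1 := div_le_one_of_le₀ (by nlinarith) (hden hε).le
    have hθ'1 : θ' ε l ≤ Ct + 1 := by
      have := mul_le_mul_of_nonneg_right hc1 (by linarith [hτ l] : 0 ≤ (X' l).1 + ε)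
      simp only [θ']
      linarith
    have hkin : a (θ ε l) (X l).2.1 (X' l).2.1 (X' l).2.1 / (2 * θ' ε l)
        ≤ K * Cp * ((T + (l₁ - l₀)) / T) := by
      have hpos : 0 < (X' l).1 + ε := by linarith [hτ l]
      calc _ ≤ K * a (X l).1 (X l).2.1 (X' l).2.1 (X' l).2.1 / (2 * θ' ε l) :=
            div_le_div_of_nonneg_right (hK _ (hθmem hε h) l h _)
              (by linarith [hθ'pos hε l])
        _ = K * (a (X l).1 (X l).2.1 (X' l).2.1 (X' l).2.1 / (2 * ((X' l).1 + ε)))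
              * (c ε)⁻¹ := by
            have := (hcpos hε).ne'
            simp only [θ']
            field_simp
        _ ≤ K * Cp * ((T + (l₁ - l₀)) / T) := by
            have := hk.trans hp.2
            have := (hcpos hε).le
            gcongr
            exact mul_nonneg hK0 (hk0.trans (hk.trans hp.2))
    have hpot : -(𝒰 (θ ε l) (X l).2.1 * θ' ε l) ≤ Cu * (Ct + 1) := by
      have := hθ'pos hε l
      nlinarith
    have hB : 0 ≤ K * Cp * ((T + (l₁ - l₀)) / T) := by
      have : 0 ≤ Cp := by linarith
      positivity
    have hB' : 0 ≤ Cu * (Ct + 1) := mul_nonneg (by linarith) (by linarith)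
    rw [abs_le]
    refine ⟨le_max_of_le_right (by linarith), max_le ?_ (by linarith)⟩
    rw [hG hε]
    linarith
  have hlim : Tendsto (fun ε => ∫ l in l₀..l₁, max (G ε l) (X' l).2.2) (𝓝[>] 0)
      (𝓝 (∫ l in l₀..l₁, (X' l).2.2)) := by
    refine intervalIntegral.tendsto_integral_filter_of_dominated_convergence
      (fun _ => K * Cp * ((T + (l₁ - l₀)) / T) + Cb + Cu * (Ct + 1) + Cy) ?_ ?_
      intervalIntegrable_const ?_
    · filter_upwards [self_mem_nhdsWithin] with ε hε
      exact ((hGc hε).max hυc).aestronglyMeasurable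
    · filter_upwards [Ioc_mem_nhdsGT (zero_lt_one' ℝ)] with ε hε
      refine Eventually.of_forall fun l h => hbound hε.1 hε.2 l ?_
      rw [uIoc_of_le hl.le] at h
      exact Ioc_subset_Icc_self h
    · refine Eventually.of_forall fun l h => hHlim l ?_
      rw [uIoc_of_le hl.le] at h
      exact Ioc_subset_Icc_self h
  rw [intervalIntegral.integral_eq_sub_of_hasDerivAt (fun l _ => hXy l)
    (hυc.intervalIntegrable _ _)] at hlim
  obtain ⟨ε, hεI, hε⟩ := ((hlim.eventually_lt_const hI).and self_mem_nhdsWithin).exists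
  obtain ⟨r, r', hr, hr', hrq, hrq'⟩ := exists_reparametrization (mul_pos (hcpos hε) hε)
    (hθd ε) (hθ'c ε) (hθ'le hε) hXq (by fun_prop)
  have hrc : Continuous r := continuous_iff_continuousAt.2 fun l => (hr l).continuousAt
  refine ⟨r, r', hr, hr', ?_, ?_, ?_⟩
  · simpa [hθ0] using hrq l₀
  · simpa [hθ1 hε] using hrq l₁
  · have := intervalIntegral.integral_comp_mul_deriv (a := l₀) (b := l₁)
      (fun l _ => hθd ε l) (hθ'c ε).continuousOn
      (continuous_classicalLag ha hb hU continuous_id hrc hr')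
    simp only [Function.comp_def, id, hrq, hrq', hθ0, hθ1 hε] at this
    rw [← this]
    refine lt_of_le_of_lt ?_ hεI
    exact intervalIntegral.integral_mono hl.le ((hGc hε).intervalIntegrable _ _)
      (((hGc hε).max hυc).intervalIntegrable _ _) fun l => le_max_left _ _

end CausalCurves

/-- The infimum of the arrival `y`-coordinate over future-directed causal C¹ curves
from `m₀ = (t₀,q₀,y₀)` to the fiber over `e₁ = (t₁,q₁)` equals `y₀` plus the
infimum of the classical action over C¹ curves from `q₀` to `q₁` (an equality in
`ℝ ∪ {−∞}`, computed in `EReal`). -/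
theorem arrival_inf_eq_action_inf (d : ℕ) (hd : 1 ≤ d)
    (a : ℝ → (Fin d → ℝ) → (Fin d → ℝ) → (Fin d → ℝ) → ℝ)
    (b : ℝ → (Fin d → ℝ) → (Fin d → ℝ) → ℝ)
    (𝒰 : ℝ → (Fin d → ℝ) → ℝ)
    (hsymm : ∀ t q v w, a t q v w = a t q w v)
    (halin : ∀ t q w, IsLinearMap ℝ (fun v => a t q v w))
    (hapos : ∀ t q v, v ≠ 0 → 0 < a t q v v)
    (hblin : ∀ t q, IsLinearMap ℝ (b t q))
    (hareg : ∀ v w, ContDiff ℝ 1 (fun p : ℝ × (Fin d → ℝ) => a p.1 p.2 v w))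
    (hbreg : ∀ v, ContDiff ℝ 1 (fun p : ℝ × (Fin d → ℝ) => b p.1 p.2 v))
    (hUreg : ContDiff ℝ 1 (fun p : ℝ × (Fin d → ℝ) => 𝒰 p.1 p.2))
    (t₀ t₁ : ℝ) (ht : t₀ < t₁) (q₀ q₁ : Fin d → ℝ) (y₀ : ℝ) :
    sInf ((fun r : ℝ => (r : EReal)) ''
        {Y : ℝ | ∃ (lam₀ lam₁ : ℝ) (x x' : ℝ → ℝ × (Fin d → ℝ) × ℝ),
          lam₀ < lam₁ ∧
          (∀ l ∈ Icc lam₀ lam₁, HasDerivWithinAt x (x' l) (Icc lam₀ lam₁) l) ∧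
          ContinuousOn x' (Icc lam₀ lam₁) ∧
          (∀ l ∈ Icc lam₀ lam₁, FDCausalB a b 𝒰 (x l) (x' l)) ∧
          x lam₀ = (t₀, q₀, y₀) ∧
          (x lam₁).1 = t₁ ∧ (x lam₁).2.1 = q₁ ∧ (x lam₁).2.2 = Y})
      = (y₀ : EReal) + sInf ((fun r : ℝ => (r : EReal)) ''
        {I : ℝ | ∃ q q' : ℝ → Fin d → ℝ,
          (∀ t ∈ Icc t₀ t₁, HasDerivWithinAt q (q' t) (Icc t₀ t₁) t) ∧
          ContinuousOn q' (Icc t₀ t₁) ∧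
          q t₀ = q₀ ∧ q t₁ = q₁ ∧
          I = ∫ s in t₀..t₁, classicalLag a b 𝒰 s (q s) (q' s)}) := by
  have ha := continuous_bilin_diag hsymm halin fun v w => (hareg v w).continuous
  have hb := continuous_of_isLinearMap_family
    (f := fun p : ℝ × (Fin d → ℝ) => b p.1 p.2) (fun p => hblin p.1 p.2)
    fun v => (hbreg v).continuous
  have hU := hUreg.continuous
  apply le_antisymm
  · rw [add_comm, ← EReal.sub_le_iff_le_add (by simp) (by simp)]
    refine le_sInf ?_
    rintro _ ⟨I, ⟨q, q', hq, hq', rfl, rfl, rfl⟩, rfl⟩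
    obtain ⟨x, x', hx, hx', hc, h₀, h₁⟩ := exists_causal_lift ha hb hU ht y₀ hq hq'
    rw [EReal.sub_le_iff_le_add (by simp) (by simp), add_comm, ← EReal.coe_add]
    exact sInf_le ⟨_, ⟨t₀, t₁, x, x', ht, fun l _ => (hx l).hasDerivWithinAt,
      hx'.continuousOn, fun l _ => hc l, h₀, by simp [h₁], by simp [h₁], by simp [h₁]⟩, rfl⟩
  · refine le_sInf ?_
    rintro _ ⟨Y, ⟨l₀, l₁, x, x', hl, hx, hx', hc, h₀, h₁, h₂, rfl⟩, rfl⟩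
    refine EReal.le_of_forall_lt_iff_le.1 fun z hz => ?_
    obtain ⟨r, r', hr, hr', hr₀, hr₁, hlt⟩ := exists_action_lt_of_causal hsymm halin hapos hblin
      ha hb hU hl hx hx' hc (by rwa [h₀, h₁]) (I := z - y₀)
      (by rw [h₀]; linarith [EReal.coe_lt_coe_iff.1 hz])
    rw [h₀, h₁] at hlt
    rw [h₀] at hr₀
    rw [h₁, h₂] at hr₁
    refine (add_le_add le_rfl (sInf_le (mem_image_of_mem _ ?_))).trans
      (b := (y₀ : EReal) + (∫ s in t₀..t₁, classicalLag a b 𝒰 s (r s) (r' s) : ℝ)) ?_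
    · exact ⟨r, r', fun t _ => (hr t).hasDerivWithinAt, hr'.continuousOn, hr₀, hr₁, rfl⟩
    · rw [← EReal.coe_add, EReal.coe_le_coe_iff]
      linarith
end
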